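/- Let ζ ∈ 𝕋. The following are equivalent: (1) ζ is a bounded point evaluation of D(μ), i.e. there is a constant C > 0 such that |p(ζ)| ≤ C‖p‖_μ for every polynomial p; (2) the polynomial z − ζ is not cyclic for D(μ); (3) c_μ({ζ}) > 0. -/

import Mathlib

open MeasureTheory Metric Filter Complex Set
open scoped ENNReal Topology

noncomputable section

namespace DirichletMu

/-- The open unit disc in `ℂ`. -/
def disc : Set ℂ := Metric.ball 0 1

/-- The unit circle `𝕋`. -/
def circleT : Set ℂ := Metric.sphere 0 1

/-- The boundary point `e^{it}`. -/
def bpt (t : ℝ) : ℂ := Complex.exp (Complex.I * (t : ℂ))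

/-- Arc-length parametrizing measure on `(0, 2π]`. -/
def θm : Measure ℝ := volume.restrict (Set.Ioc 0 (2 * Real.pi))

/-- A measure is carried by the unit circle. -/
def OnCircle (μ : Measure ℂ) : Prop := μ circleTᶜ = 0

/-- The mean-square integrals of `f` over circles of radius `r < 1`. -/
def hardySet (f : ℂ → ℂ) : Set ℝ :=
  {x | ∃ r : ℝ, 0 < r ∧ r < 1 ∧
    x = (1 / (2 * Real.pi)) * ∫ t in (0:ℝ)..(2 * Real.pi), ‖f ((r : ℂ) * bpt t)‖ ^ 2}

/-- Membership in the Hardy space `H²`. -/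
def MemHardy2 (f : ℂ → ℂ) : Prop :=
  DifferentiableOn ℂ f disc ∧ BddAbove (hardySet f)

/-- The squared Hardy norm. -/
def hardyNormSq (f : ℂ → ℂ) : ℝ := sSup (hardySet f)

/-- Membership in `H^∞`. -/
def MemHinf (f : ℂ → ℂ) : Prop :=
  DifferentiableOn ℂ f disc ∧ ∃ C : ℝ, ∀ z ∈ disc, ‖f z‖ ≤ C

/-- The sup norm over the disc. -/
def supNorm (f : ℂ → ℂ) : ℝ := sSup ((fun z => ‖f z‖) '' disc)

/-- The Poisson integral of the measure `μ`. -/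
def poissonMu (μ : Measure ℂ) (z : ℂ) : ℝ :=
  ∫ ζ, (1 - ‖z‖ ^ 2) / ‖1 - (starRingEnd ℂ) ζ * z‖ ^ 2 ∂μ

/-- The integrand of the Dirichlet integral. -/
def dirichletDensity (μ : Measure ℂ) (f : ℂ → ℂ) (z : ℂ) : ℝ :=
  ‖deriv f z‖ ^ 2 * poissonMu μ z

/-- The Dirichlet integral `D_μ(f)`. -/
def dirichletIntegral (μ : Measure ℂ) (f : ℂ → ℂ) : ℝ :=
  (1 / Real.pi) * ∫ z in disc, dirichletDensity μ f z

/-- Membership in the Dirichlet-type space `D(μ)`. -/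
def MemD (μ : Measure ℂ) (f : ℂ → ℂ) : Prop :=
  MemHardy2 f ∧ IntegrableOn (dirichletDensity μ f) disc

/-- The squared norm `‖f‖_μ²` of `D(μ)`. -/
def dNormSq (μ : Measure ℂ) (f : ℂ → ℂ) : ℝ :=
  hardyNormSq f + dirichletIntegral μ f

/-- `f` has radial limit `L` at `ζ`. -/
def HasRadialLimitAt (f : ℂ → ℂ) (ζ L : ℂ) : Prop :=
  Tendsto (fun r : ℝ => f ((r : ℂ) * ζ)) (nhdsWithin 1 (Set.Iio 1)) (nhds L)

/-- The modulus of `f` has radial limit `m` at `e^{it}`. -/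
def BoundaryAbs (f : ℂ → ℂ) (t : ℝ) (m : ℝ) : Prop :=
  Tendsto (fun r : ℝ => ‖f ((r : ℂ) * bpt t)‖) (nhdsWithin 1 (Set.Iio 1)) (nhds m)

/-- The boundary zero set `Z_𝕋(f)`. -/
def ZT (f : ℂ → ℂ) : Set ℂ :=
  {ζ | ζ ∈ circleT ∧ HasRadialLimitAt f ζ 0}

/-- The set `Z̲(f)`. -/
def Zlow (f : ℂ → ℂ) : Set ℂ :=
  {ζ | ζ ∈ Metric.closedBall (0 : ℂ) 1 ∧
    Filter.liminf (fun z => ‖f z‖) (nhdsWithin ζ disc) = 0}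

def ZlowSet (S : Set (ℂ → ℂ)) : Set ℂ := ⋂ f ∈ S, Zlow f

def ZTSet (S : Set (ℂ → ℂ)) : Set ℂ := ⋂ f ∈ S, ZT f

/-- `[f]_{D(μ)}`: the closure in `D(μ)` of the polynomial multiples of `f`. -/
def closedSpan (μ : Measure ℂ) (f : ℂ → ℂ) : Set (ℂ → ℂ) :=
  {g | MemD μ g ∧ ∀ ε > 0, ∃ q : Polynomial ℂ,
    dNormSq μ (fun z => g z - q.eval z * f z) < ε}

/-- `f` is cyclic for `D(μ)`. -/
def IsCyclic (μ : Measure ℂ) (f : ℂ → ℂ) : Prop :=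
  closedSpan μ f = {g | MemD μ g}

/-- `f` is the outer function with boundary modulus `φ` (parametrized by `e^{it}`). -/
def OuterWith (f : ℂ → ℂ) (φ : ℝ → ℝ) : Prop :=
  (∀ t, 0 ≤ φ t) ∧
  IntervalIntegrable (fun t => Real.log (φ t)) volume 0 (2 * Real.pi) ∧
  ∀ z ∈ disc, f z = Complex.exp (((2 * Real.pi : ℝ) : ℂ)⁻¹ *
    ∫ t in (0:ℝ)..(2 * Real.pi), ((bpt t + z) / (bpt t - z)) * (Real.log (φ t) : ℂ))

/-- `f` is an outer function. -/
def IsOuter (f : ℂ → ℂ) : Prop := ∃ φ, OuterWith f φ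

/-- Inner functions. -/
def IsInner (f : ℂ → ℂ) : Prop :=
  DifferentiableOn ℂ f disc ∧ (∀ z ∈ disc, ‖f z‖ ≤ 1) ∧
  ∀ᵐ t ∂θm, BoundaryAbs f t 1

/-- `f / Θ ∈ H²`. -/
def InnerDivides (Θ f : ℂ → ℂ) : Prop :=
  ∃ g, MemHardy2 g ∧ ∀ z ∈ disc, f z = Θ z * g z

/-- `Θ / Θ'` is bounded on the disc. -/
def DividesBdd (Θ' Θ : ℂ → ℂ) : Prop :=
  ∃ g, MemHinf g ∧ ∀ z ∈ disc, Θ z = Θ' z * g z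

/-- `Θ` is the greatest common inner divisor of the family `M`. -/
def IsGCDInner (M : Set (ℂ → ℂ)) (Θ : ℂ → ℂ) : Prop :=
  IsInner Θ ∧ (∀ f ∈ M, InnerDivides Θ f) ∧
  ∀ Θ', IsInner Θ' → (∀ f ∈ M, InnerDivides Θ' f) → DividesBdd Θ' Θ

/-- The set `Θ H²`. -/
def innerMulH2 (Θ : ℂ → ℂ) : Set (ℂ → ℂ) :=
  {h | ∃ g, MemHardy2 g ∧ ∀ z ∈ disc, h z = Θ z * g z}

/-- Poisson extension of a boundary function (parametrized by `e^{it}`). -/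
def poissonExt (u : ℝ → ℝ) (z : ℂ) : ℝ :=
  (1 / (2 * Real.pi)) * ∫ t in (0:ℝ)..(2 * Real.pi),
    ((1 - ‖z‖ ^ 2) / ‖bpt t - z‖ ^ 2) * u t

/-- `|∇ P[u]|² P_μ`. -/
def gradDensity (μ : Measure ℂ) (u : ℝ → ℝ) (z : ℂ) : ℝ :=
  ‖fderiv ℝ (poissonExt u) z‖ ^ 2 * poissonMu μ z

/-- Membership in the harmonic Dirichlet space `D^h(μ)`. -/
def MemDh (μ : Measure ℂ) (u : ℝ → ℝ) : Prop :=
  IntegrableOn (fun t => (u t) ^ 2) (Set.Ioc 0 (2 * Real.pi)) volume ∧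
  IntegrableOn (gradDensity μ u) disc

/-- The squared norm of `D^h(μ)`. -/
def dhNormSq (μ : Measure ℂ) (u : ℝ → ℝ) : ℝ :=
  (1 / (2 * Real.pi)) * (∫ t in Set.Ioc 0 (2 * Real.pi), (u t) ^ 2) +
  (1 / Real.pi) * ∫ z in disc, gradDensity μ u z

/-- Relatively open subsets of the circle. -/
def RelOpen (U : Set ℂ) : Prop := ∃ V : Set ℂ, IsOpen V ∧ U = V ∩ circleT

/-- Capacity of a relatively open subset of the circle. -/
def capOpen (μ : Measure ℂ) (U : Set ℂ) : ℝ≥0∞ :=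
  ⨅ (u : ℝ → ℝ) (_ : MemDh μ u ∧ (∀ t, 0 ≤ u t) ∧
      ∀ᵐ t ∂θm, bpt t ∈ U → 1 ≤ u t),
    ENNReal.ofReal (dhNormSq μ u)

/-- The capacity `c_μ` of an arbitrary subset of the circle. -/
def cap (μ : Measure ℂ) (F : Set ℂ) : ℝ≥0∞ :=
  ⨅ (U : Set ℂ) (_ : RelOpen U ∧ F ⊆ U), capOpen μ U

/-- The (closed) support of a measure on `ℂ`. -/
def msupport (μ : Measure ℂ) : Set ℂ :=
  {x | ∀ r > 0, 0 < μ (Metric.ball x r)}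

/-- `M_μ(E)`: functions of `D(μ)` whose radial limits vanish `c_μ`-q.e. on `E`. -/
def Mspace (μ : Measure ℂ) (E : Set ℂ) : Set (ℂ → ℂ) :=
  {g | MemD μ g ∧ ∃ N : Set ℂ, cap μ N = 0 ∧ ∀ ζ ∈ E \ N, HasRadialLimitAt g ζ 0}

/-- Closed shift-invariant subspaces of `D(μ)` (closedness for the `D(μ)` norm). -/
structure ClosedInvSubspace (μ : Measure ℂ) (M : Set (ℂ → ℂ)) : Prop where
  subset : M ⊆ {f | MemD μ f}
  zero_mem : (fun _ => (0 : ℂ)) ∈ M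
  add_mem : ∀ f ∈ M, ∀ g ∈ M, (fun z => f z + g z) ∈ M
  smul_mem : ∀ (c : ℂ), ∀ f ∈ M, (fun z => c * f z) ∈ M
  shift_mem : ∀ f ∈ M, (fun z => z * f z) ∈ M
  closed : ∀ g, MemD μ g →
    (∀ ε > 0, ∃ h ∈ M, dNormSq μ (fun z => g z - h z) < ε) → g ∈ M

/-- The norm `‖f‖_{∞,μ}` of the Banach algebra `D(μ) ∩ H^∞`. -/
def algNorm (μ : Measure ℂ) (f : ℂ → ℂ) : ℝ :=
  supNorm f + Real.sqrt (dirichletIntegral μ f)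

/-- Membership in the Banach algebra `D(μ) ∩ H^∞`. -/
def MemA (μ : Measure ℂ) (f : ℂ → ℂ) : Prop := MemD μ f ∧ MemHinf f

/-- Closed ideals of `D(μ) ∩ H^∞`. -/
structure ClosedIdeal (μ : Measure ℂ) (J : Set (ℂ → ℂ)) : Prop where
  subset : J ⊆ {f | MemA μ f}
  zero_mem : (fun _ => (0 : ℂ)) ∈ J
  add_mem : ∀ f ∈ J, ∀ g ∈ J, (fun z => f z + g z) ∈ J
  mul_mem : ∀ f, MemA μ f → ∀ g ∈ J, (fun z => f z * g z) ∈ J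
  closed : ∀ g, MemA μ g →
    (∀ ε > 0, ∃ h ∈ J, algNorm μ (fun z => g z - h z) < ε) → g ∈ J

/-- A multiplier of `D(μ)`. -/
def IsMultiplier (μ : Measure ℂ) (φ : ℂ → ℂ) : Prop :=
  DifferentiableOn ℂ φ disc ∧ ∀ g, MemD μ g → MemD μ (fun z => φ z * g z)

/-- Distance between two subsets of `ℂ`. -/
def setDist (A B : Set ℂ) : ℝ :=
  sInf ((fun p : ℂ × ℂ => dist p.1 p.2) '' (A ×ˢ B))

section

open Real (circleAverage)

variable {μ : Measure ℂ}

/-- The Poisson kernel of the unit disc, with boundary point `ζ` and pole `z`. -/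
def diskKernel (ζ z : ℂ) : ℝ := (1 - ‖z‖ ^ 2) / ‖1 - (starRingEnd ℂ) ζ * z‖ ^ 2

lemma norm_one_sub_conj_mul {ζ : ℂ} (hζ : ‖ζ‖ = 1) (z : ℂ) :
    ‖1 - (starRingEnd ℂ) ζ * z‖ = ‖ζ - z‖ := by
  have h : ζ * (1 - (starRingEnd ℂ) ζ * z) = ζ - z := by
    rw [mul_sub, ← mul_assoc, Complex.mul_conj']; simp [hζ]
  rw [← h, norm_mul, hζ, one_mul]

lemma diskKernel_eq {ζ : ℂ} (hζ : ‖ζ‖ = 1) (z : ℂ) :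
    diskKernel ζ z = (1 - ‖z‖ ^ 2) / ‖ζ - z‖ ^ 2 := by
  rw [diskKernel, norm_one_sub_conj_mul hζ]

lemma diskKernel_eq_poissonKernel {ζ : ℂ} (hζ : ‖ζ‖ = 1) (z : ℂ) :
    diskKernel ζ z = poissonKernel 0 z ζ := by
  rw [diskKernel_eq hζ, poissonKernel_def]; simp [hζ]

lemma diskKernel_eq_re {ζ : ℂ} (hζ : ‖ζ‖ = 1) (z : ℂ) :
    diskKernel ζ z = ((ζ + z) / (ζ - z)).re := by
  rw [diskKernel_eq_poissonKernel hζ, poissonKernel_eq_re_herglotzRieszKernel]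
  simp [herglotzRieszKernel_def]

lemma diskKernel_nonneg (ζ : ℂ) {z : ℂ} (hz : ‖z‖ ≤ 1) : 0 ≤ diskKernel ζ z := by
  have : 0 ≤ 1 - ‖z‖ ^ 2 := by nlinarith [norm_nonneg z]
  unfold diskKernel; positivity

lemma diskKernel_swap {ζ w : ℂ} (hζ : ‖ζ‖ = 1) (hw : ‖w‖ = 1) (ρ : ℝ) :
    diskKernel ζ (ρ * w) = diskKernel w (ρ * ζ) := by
  unfold diskKernel
  have h1 : ‖(ρ : ℂ) * w‖ = ‖(ρ : ℂ) * ζ‖ := by simp [hζ, hw]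
  have h2 : 1 - (starRingEnd ℂ) w * (ρ * ζ) = (starRingEnd ℂ) (1 - (starRingEnd ℂ) ζ * (ρ * w)) := by
    simp; ring
  rw [h1, h2, Complex.norm_conj]

lemma measurable_diskKernel : Measurable (fun p : ℂ × ℂ => diskKernel p.1 p.2) := by
  unfold diskKernel
  have : Measurable (starRingEnd ℂ) := Complex.continuous_conj.measurable
  fun_prop

lemma sub_ne_zero_of_norm_lt {ζ z : ℂ} (hζ : ‖ζ‖ = 1) (hz : ‖z‖ < 1) : ζ - z ≠ 0 := by
  intro h; rw [sub_eq_zero] at h; rw [h] at hζ; linarith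

lemma continuousOn_diskKernel :
    ContinuousOn (fun p : ℂ × ℂ => diskKernel p.1 p.2) (sphere 0 1 ×ˢ ball 0 1) := by
  unfold diskKernel
  refine ContinuousOn.div (by fun_prop) ?_ ?_
  · exact ((continuous_const.sub ((Complex.continuous_conj.comp continuous_fst).mul
      continuous_snd)).norm.pow 2).continuousOn
  · rintro ⟨ζ, z⟩ ⟨h1, h2⟩
    simp only [mem_sphere_iff_norm, sub_zero, mem_ball_zero_iff] at h1 h2
    have := norm_pos_iff.2 (sub_ne_zero_of_norm_lt h1 h2)
    simp only [norm_one_sub_conj_mul h1]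
    positivity

lemma continuousOn_diskKernel_right {ζ : ℂ} (hζ : ‖ζ‖ = 1) :
    ContinuousOn (diskKernel ζ) (ball 0 1) :=
  continuousOn_diskKernel.comp (f := fun z => (ζ, z)) (by fun_prop)
    (fun z hz => ⟨by simpa using hζ, hz⟩)

lemma continuousOn_diskKernel_left {z : ℂ} (hz : ‖z‖ < 1) :
    ContinuousOn (fun ζ => diskKernel ζ z) (sphere 0 1) :=
  continuousOn_diskKernel.comp (f := fun ζ => (ζ, z)) (by fun_prop)
    (fun ζ hζ => ⟨hζ, by simpa using hz⟩)

lemma circleAverage_diskKernel_smul {f : ℂ → ℂ} (hf : DiffContOnCl ℂ f (ball 0 1)) {w : ℂ}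
    (hw : ‖w‖ < 1) : circleAverage (fun v => diskKernel v w • f v) 0 1 = f w := by
  rw [← hf.circleAverage_poissonKernel_smul (w := w) (by simpa using hw)]
  apply Real.circleAverage_congr_sphere
  intro v hv
  simp only [abs_one, mem_sphere_iff_norm, sub_zero] at hv
  simp [diskKernel_eq_poissonKernel hv]

lemma circleIntegrable_of_continuousOn_unit {E : Type*} [NormedAddCommGroup E] {f : ℂ → E}
    (hf : ContinuousOn f (sphere 0 1)) : CircleIntegrable f 0 1 :=
  hf.circleIntegrable zero_le_one

lemma continuousOn_sphere_of_diffContOnCl {f : ℂ → ℂ} (hf : DiffContOnCl ℂ f (ball 0 1)) :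
    ContinuousOn f (sphere 0 1) :=
  hf.continuousOn_ball.mono sphere_subset_closedBall

lemma circleAverage_diskKernel_mul_re {f : ℂ → ℂ} (hf : DiffContOnCl ℂ f (ball 0 1)) {w : ℂ}
    (hw : ‖w‖ < 1) : circleAverage (fun v => diskKernel v w * (f v).re) 0 1 = (f w).re := by
  have h := Complex.reCLM.circleAverage_comp_comm (c := 0) (R := 1)
    (f := fun v => diskKernel v w • f v) (circleIntegrable_of_continuousOn_unit
      ((continuousOn_diskKernel_left hw).smul (continuousOn_sphere_of_diffContOnCl hf)))
  rw [circleAverage_diskKernel_smul hf hw] at h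
  rw [← Complex.reCLM_apply, ← h]
  congr 1; ext v; simp

lemma norm_sq_le_circleAverage {h : ℂ → ℂ} (hh : DiffContOnCl ℂ h (ball 0 1)) {w : ℂ}
    (hw : ‖w‖ < 1) : ‖h w‖ ^ 2 ≤ circleAverage (fun v => diskKernel v w * ‖h v‖ ^ 2) 0 1 := by
  set a := h w with ha
  have hf : DiffContOnCl ℂ (fun v => 2 * (starRingEnd ℂ) a * h v - (‖a‖ : ℂ) ^ 2) (ball 0 1) :=
    (hh.const_smul (2 * (starRingEnd ℂ) a)).sub diffContOnCl_const
  have h1 := circleAverage_diskKernel_mul_re hf hw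
  have h2 : (2 * (starRingEnd ℂ) a * h w - (‖a‖ : ℂ) ^ 2).re = ‖a‖ ^ 2 := by
    rw [← ha, mul_assoc, Complex.conj_mul']
    norm_cast; ring
  rw [h2] at h1
  rw [← h1]
  have hk := continuousOn_diskKernel_left hw
  have hc := continuousOn_sphere_of_diffContOnCl hh
  apply Real.circleAverage_mono
  · apply circleIntegrable_of_continuousOn_unit
    exact hk.mul (Complex.continuous_re.comp_continuousOn (continuousOn_sphere_of_diffContOnCl hf))
  · apply circleIntegrable_of_continuousOn_unit
    exact hk.mul (hc.norm.pow 2)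
  · intro v _
    apply mul_le_mul_of_nonneg_left _ (diskKernel_nonneg v hw.le)
    have h3 : 0 ≤ ‖h v - a‖ ^ 2 := by positivity
    rw [← Complex.normSq_eq_norm_sq] at *
    simp only [Complex.normSq_apply, Complex.sub_re, Complex.sub_im, Complex.mul_re,
      Complex.mul_im, Complex.conj_re, Complex.conj_im] at *
    have : ((‖a‖ : ℂ) ^ 2).re = a.re * a.re + a.im * a.im := by
      rw [← Complex.normSq_apply, Complex.normSq_eq_norm_sq]; norm_cast
    rw [this]
    simp
    nlinarith

lemma circleAverage_circleAverage_swap {F : ℂ → ℂ → ℝ}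
    (hF : ContinuousOn (Function.uncurry F) (sphere 0 1 ×ˢ sphere 0 1)) :
    circleAverage (fun v => circleAverage (fun w => F v w) 0 1) 0 1 =
      circleAverage (fun w => circleAverage (fun v => F v w) 0 1) 0 1 := by
  simp only [Real.circleAverage_def, smul_eq_mul, intervalIntegral.integral_const_mul]
  congr 2
  apply intervalIntegral_intervalIntegral_swap
  have hc : Continuous (Function.uncurry fun s t : ℝ => F (circleMap 0 1 s) (circleMap 0 1 t)) :=
    hF.comp_continuous (f := fun p : ℝ × ℝ => (circleMap 0 1 p.1, circleMap 0 1 p.2))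
      (by fun_prop) (fun p => ⟨circleMap_mem_sphere _ zero_le_one _,
        circleMap_mem_sphere _ zero_le_one _⟩)
  exact (hc.continuousOn.integrableOn_compact (isCompact_uIcc.prod isCompact_uIcc)).mono_set
    (prod_mono uIoc_subset_uIcc uIoc_subset_uIcc)

lemma circleAverage_dilation_le {k G : ℂ → ℂ} (hk : DiffContOnCl ℂ k (ball 0 1))
    (hG : DiffContOnCl ℂ G (ball 0 1)) (hG0 : ∀ v ∈ sphere (0 : ℂ) 1, 0 ≤ (G v).re)
    {σ : ℝ} (hσ0 : 0 ≤ σ) (hσ : σ < 1) :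
    circleAverage (fun v => ‖k (σ * v)‖ ^ 2 * (G v).re) 0 1 ≤
      circleAverage (fun w => ‖k w‖ ^ 2 * (G (σ * w)).re) 0 1 := by
  have hn : ∀ v ∈ sphere (0 : ℂ) 1, ‖(σ : ℂ) * v‖ < 1 := by
    intro v hv
    simp only [mem_sphere_iff_norm, sub_zero] at hv
    simpa [hv, abs_of_nonneg hσ0] using hσ
  have hkc := continuousOn_sphere_of_diffContOnCl hk
  have hGc := continuousOn_sphere_of_diffContOnCl hG
  have hker : ContinuousOn (fun p : ℂ × ℂ => diskKernel p.2 (σ * p.1))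
      (sphere 0 1 ×ˢ sphere 0 1) :=
    continuousOn_diskKernel.comp (f := fun p : ℂ × ℂ => (p.2, (σ : ℂ) * p.1))
      (by fun_prop) (fun p hp => ⟨hp.2, by simpa using hn p.1 hp.1⟩)
  have hF : ContinuousOn (Function.uncurry fun v w : ℂ =>
      diskKernel w (σ * v) * ‖k w‖ ^ 2 * (G v).re) (sphere 0 1 ×ˢ sphere 0 1) := by
    refine (hker.mul ?_).mul ?_
    · exact ((hkc.comp (f := Prod.snd) (by fun_prop) (fun p hp => hp.2)).norm.pow 2)
    · exact Complex.continuous_re.comp_continuousOn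
        (hGc.comp (f := Prod.fst) (by fun_prop) (fun p hp => hp.1))
  have hkσ : ContinuousOn (fun v => k (σ * v)) (sphere 0 1) :=
    hk.continuousOn_ball.comp (by fun_prop) (fun v hv => by simpa using (hn v hv).le)
  calc circleAverage (fun v => ‖k (σ * v)‖ ^ 2 * (G v).re) 0 1
      ≤ circleAverage (fun v => circleAverage (fun w =>
          diskKernel w (σ * v) * ‖k w‖ ^ 2 * (G v).re) 0 1) 0 1 := by
        apply Real.circleAverage_mono
        · apply circleIntegrable_of_continuousOn_unit
          exact (hkσ.norm.pow 2).mul (Complex.continuous_re.comp_continuousOn hGc)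
        · have hc : Continuous (Function.uncurry fun s t : ℝ =>
              diskKernel (circleMap 0 1 t) (σ * circleMap 0 1 s) * ‖k (circleMap 0 1 t)‖ ^ 2
                * (G (circleMap 0 1 s)).re) :=
            hF.comp_continuous (f := fun p : ℝ × ℝ => (circleMap 0 1 p.1, circleMap 0 1 p.2))
              (by fun_prop) (fun p => ⟨circleMap_mem_sphere _ zero_le_one _,
                circleMap_mem_sphere _ zero_le_one _⟩)
          apply Continuous.intervalIntegrable
          simp only [Real.circleAverage_def]
          exact (intervalIntegral.continuous_parametric_intervalIntegral_of_continuous'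
            (μ := volume) hc 0 (2 * Real.pi)).const_smul ((2 * Real.pi)⁻¹ : ℝ)
        · intro v hv
          rw [abs_one] at hv
          have h1 := norm_sq_le_circleAverage hk (hn v hv)
          have h2 := mul_le_mul_of_nonneg_right h1 (hG0 v hv)
          refine h2.trans (le_of_eq ?_)
          rw [mul_comm, ← smul_eq_mul, ← Real.circleAverage_fun_smul]
          congr 1; ext w; simp only [smul_eq_mul]; ring
    _ = circleAverage (fun w => circleAverage (fun v =>
          diskKernel w (σ * v) * ‖k w‖ ^ 2 * (G v).re) 0 1) 0 1 :=
        circleAverage_circleAverage_swap hF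
    _ = circleAverage (fun w => ‖k w‖ ^ 2 * (G (σ * w)).re) 0 1 := by
        apply Real.circleAverage_congr_sphere
        intro w hw
        rw [abs_one] at hw
        simp only
        rw [← circleAverage_diskKernel_mul_re hG (hn w hw), ← smul_eq_mul (‖k w‖ ^ 2),
          ← Real.circleAverage_fun_smul]
        apply Real.circleAverage_congr_sphere
        intro v hv
        rw [abs_one] at hv
        simp only [mem_sphere_iff_norm, sub_zero] at hv hw
        simp only [smul_eq_mul]
        rw [diskKernel_swap hw hv]; ring

lemma circleAverage_ofReal_radius {F : ℂ → ℝ} (ρ : ℝ) :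
    circleAverage F 0 ρ = circleAverage (fun z => F (ρ * z)) 0 1 := by
  rw [Real.circleAverage_eq_circleAverage_zero_one]; simp

lemma mul_bpt (r t : ℝ) : (r : ℂ) * bpt t = circleMap 0 r t := by
  simp [bpt, circleMap, mul_comm]

lemma integral_circleMap_eq (F : ℂ → ℝ) (ρ : ℝ) :
    ∫ θ in (-Real.pi)..Real.pi, F (circleMap 0 ρ θ) = 2 * Real.pi * circleAverage F 0 ρ := by
  rw [Real.circleAverage_eq_integral_add (-Real.pi),
    intervalIntegral.integral_comp_add_right (fun θ => F (circleMap 0 ρ θ))]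
  have : 2 * Real.pi + -Real.pi = Real.pi := by ring
  rw [zero_add, this, smul_eq_mul, mul_inv_cancel_left₀ (by positivity)]

lemma circleMap_mem_disc {ρ : ℝ} (h0 : 0 ≤ ρ) (h1 : ρ < 1) (θ : ℝ) :
    circleMap 0 ρ θ ∈ disc := by
  simp [disc, abs_of_nonneg h0, h1]

lemma measurableSet_disc : MeasurableSet disc := measurableSet_ball

lemma lintegral_disc_eq {F : ℂ → ℝ} (hF : ContinuousOn F disc) (h0 : ∀ z ∈ disc, 0 ≤ F z) :
    ∫⁻ z in disc, ENNReal.ofReal (F z) =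
      ∫⁻ ρ in Ioo (0 : ℝ) 1, ENNReal.ofReal (2 * Real.pi * ρ * circleAverage F 0 ρ) := by
  have hmeas : Measurable (disc.indicator fun z => ENNReal.ofReal (F z)) := by
    apply measurable_of_restrict_of_restrict_compl measurableSet_disc
    · have : disc.domRestrict (disc.indicator fun z => ENNReal.ofReal (F z)) =
          disc.domRestrict fun z => ENNReal.ofReal (F z) := by
        ext z; simp [domRestrict_apply]
      rw [this]
      exact (ENNReal.continuous_ofReal.comp_continuousOn hF).domRestrict.measurable
    · have : discᶜ.domRestrict (disc.indicator fun z => ENNReal.ofReal (F z)) = fun _ => 0 := by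
        ext z; simp only [domRestrict_apply, indicator_of_notMem z.2]
      rw [this]; exact measurable_const
  rw [← lintegral_indicator measurableSet_disc, ← Complex.lintegral_comp_polarCoord_symm]
  have htgt : polarCoord.target = Ioi (0 : ℝ) ×ˢ Ioo (-Real.pi) Real.pi := rfl
  have hsymm : Measurable (Complex.polarCoord.symm : ℝ × ℝ → ℂ) := by
    have : (Complex.polarCoord.symm : ℝ × ℝ → ℂ) =
        fun p => (p.1 : ℂ) * (Real.cos p.2 + Real.sin p.2 * Complex.I) := by
      ext p; exact Complex.polarCoord_symm_apply p
    rw [this]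
    exact (by fun_prop : Continuous _).measurable
  rw [htgt, Measure.volume_eq_prod, setLIntegral_prod _ (by
    simp only [smul_eq_mul]
    exact ((ENNReal.measurable_ofReal.comp measurable_fst).mul (hmeas.comp hsymm)).aemeasurable)]
  have hsub : Ioo (0 : ℝ) 1 ⊆ Ioi 0 := fun x hx => hx.1
  have key : ∀ ρ ∈ Ioi (0 : ℝ), (∫⁻ θ in Ioo (-Real.pi) Real.pi, ENNReal.ofReal ρ •
      disc.indicator (fun z => ENNReal.ofReal (F z)) (Complex.polarCoord.symm (ρ, θ))) =
      (Ioo (0 : ℝ) 1).indicator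
        (fun ρ => ENNReal.ofReal (2 * Real.pi * ρ * circleAverage F 0 ρ)) ρ := by
    intro ρ hρ
    rw [mem_Ioi] at hρ
    have hs : ∀ θ, Complex.polarCoord.symm (ρ, θ) = circleMap 0 ρ θ := by
      intro θ
      rw [Complex.polarCoord_symm_apply, circleMap, Complex.exp_mul_I]; simp
    by_cases h1 : ρ < 1
    · rw [indicator_of_mem (show ρ ∈ Ioo (0 : ℝ) 1 from ⟨hρ, h1⟩)]
      have hm : ∀ θ, circleMap 0 ρ θ ∈ disc := circleMap_mem_disc hρ.le h1
      have hc : Continuous fun θ => F (circleMap 0 ρ θ) :=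
        hF.comp_continuous (by fun_prop) hm
      simp only [hs, indicator_of_mem (hm _), smul_eq_mul]
      rw [lintegral_const_mul _ hc.measurable.ennreal_ofReal,
        ← ofReal_integral_eq_lintegral_ofReal, ← ENNReal.ofReal_mul hρ.le,
        ← integral_Ioc_eq_integral_Ioo, ← intervalIntegral.integral_of_le (by linarith [Real.pi_pos]),
        integral_circleMap_eq]
      · congr 1; ring
      · exact (hc.continuousOn.integrableOn_compact isCompact_Icc).mono_set Ioo_subset_Icc_self
      · exact ae_of_all _ fun θ => h0 _ (hm θ)
    · rw [indicator_of_notMem (by simp [h1])]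
      have hm : ∀ θ, circleMap 0 ρ θ ∉ disc := by
        intro θ
        simpa [disc, abs_of_pos hρ] using h1
      simp [hs, indicator_of_notMem (hm _)]
  rw [setLIntegral_congr_fun measurableSet_Ioi key, lintegral_indicator measurableSet_Ioo,
    Measure.restrict_restrict measurableSet_Ioo, inter_eq_self_of_subset_left hsub]

lemma diffContOnCl_comp_mul {h : ℂ → ℂ} (hh : DifferentiableOn ℂ h disc) {ρ : ℝ} (h0 : 0 ≤ ρ)
    (h1 : ρ < 1) : DiffContOnCl ℂ (fun z => h (ρ * z)) (ball 0 1) := by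
  apply DifferentiableOn.diffContOnCl
  rw [closure_ball _ one_ne_zero]
  refine hh.comp (by fun_prop) ?_
  intro z hz
  simp only [mem_closedBall, dist_zero_right] at hz
  simp only [disc, mem_ball, dist_zero_right, norm_mul, Complex.norm_real, Real.norm_eq_abs,
    abs_of_nonneg h0]
  nlinarith [norm_nonneg z]

/-- Circle means of `|h|²` decrease under dilation. -/
lemma circleAverage_norm_sq_dilation_le {h : ℂ → ℂ} (hh : DifferentiableOn ℂ h disc) {ρ r : ℝ}
    (h0 : 0 ≤ ρ) (h1 : ρ < 1) (hr0 : 0 ≤ r) (hr1 : r ≤ 1) :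
    circleAverage (fun z => ‖h (r * z)‖ ^ 2) 0 ρ ≤ circleAverage (fun z => ‖h z‖ ^ 2) 0 ρ := by
  rcases hr1.eq_or_lt with rfl | hr1
  · simp
  rw [circleAverage_ofReal_radius (F := fun z => ‖h (r * z)‖ ^ 2),
    circleAverage_ofReal_radius (F := fun z => ‖h z‖ ^ 2)]
  have := circleAverage_dilation_le (diffContOnCl_comp_mul hh h0 h1)
    (G := fun _ => 1) diffContOnCl_const (by simp) hr0 hr1
  simp only [Complex.one_re, mul_one] at this
  convert this using 5
  ring_nf

lemma circleAverage_norm_sq_mono {h : ℂ → ℂ} (hh : DifferentiableOn ℂ h disc) {a b : ℝ}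
    (h0 : 0 ≤ a) (hab : a ≤ b) (hb : b < 1) :
    circleAverage (fun z => ‖h z‖ ^ 2) 0 a ≤ circleAverage (fun z => ‖h z‖ ^ 2) 0 b := by
  rcases (h0.trans hab).eq_or_lt with rfl | hb0
  · rw [le_antisymm hab h0]
  have := circleAverage_norm_sq_dilation_le hh hb0.le hb (r := a / b) (by positivity)
    ((div_le_one hb0).2 hab)
  refine le_trans (le_of_eq ?_) this
  rw [circleAverage_ofReal_radius a, circleAverage_ofReal_radius b]
  congr 1; ext z
  congr 3
  have hb' : (b : ℂ) ≠ 0 := by exact_mod_cast hb0.ne'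
  push_cast
  field_simp

lemma circleAverage_weighted_dilation_le {h : ℂ → ℂ} (hh : DifferentiableOn ℂ h disc) {ζ : ℂ}
    (hζ : ‖ζ‖ = 1) {ρ σ : ℝ} (h0 : 0 ≤ ρ) (h1 : ρ < 1) (hσ0 : 0 ≤ σ) (hσ1 : σ < 1) :
    circleAverage (fun z => ‖h ((σ ^ 2 : ℝ) * z)‖ ^ 2 * diskKernel ζ z) 0 ρ ≤
      circleAverage (fun z => ‖h z‖ ^ 2 * diskKernel ζ z) 0 (σ * ρ) := by
  rw [circleAverage_ofReal_radius (F := fun z => ‖h ((σ ^ 2 : ℝ) * z)‖ ^ 2 * diskKernel ζ z) ρ,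
    circleAverage_ofReal_radius (F := fun z => ‖h z‖ ^ 2 * diskKernel ζ z) (σ * ρ)]
  have hσρ : σ * ρ < 1 := by nlinarith
  have hG : DiffContOnCl ℂ (fun v => (ζ + ρ * v) / (ζ - ρ * v)) (ball 0 1) := by
    refine diffContOnCl_comp_mul (h := fun z => (ζ + z) / (ζ - z)) ?_ h0 h1
    refine DifferentiableOn.div (by fun_prop) (by fun_prop) ?_
    intro z hz
    exact sub_ne_zero_of_norm_lt hζ (by simpa [disc] using hz)
  have := circleAverage_dilation_le (diffContOnCl_comp_mul hh (ρ := σ * ρ) (by positivity) hσρ)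
    hG (by
      intro v hv
      rw [← diskKernel_eq_re hζ]
      apply diskKernel_nonneg
      have : ‖v‖ = 1 := by simpa using hv
      simp [this, abs_of_nonneg h0, h1.le]) hσ0 hσ1
  simp only [← diskKernel_eq_re hζ] at this
  convert this using 5
  · push_cast; ring_nf
  · push_cast; ring_nf

/-- The local Dirichlet integral at `ζ`, as an extended nonnegative real. -/
def localDirichlet (ζ : ℂ) (f : ℂ → ℂ) : ℝ≥0∞ :=
  ∫⁻ z in disc, ENNReal.ofReal (‖deriv f z‖ ^ 2 * diskKernel ζ z)

lemma isOpen_disc : IsOpen disc := isOpen_ball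

lemma deriv_comp_mul {f : ℂ → ℂ} (hf : DifferentiableOn ℂ f disc) {r : ℝ} (hr0 : 0 ≤ r)
    (hr1 : r ≤ 1) {z : ℂ} (hz : z ∈ disc) :
    deriv (fun z => f (r * z)) z = r * deriv f (r * z) := by
  have hm : (r : ℂ) * z ∈ disc := by
    simp only [disc, mem_ball, dist_zero_right, norm_mul, Complex.norm_real, Real.norm_eq_abs,
      abs_of_nonneg hr0] at hz ⊢
    nlinarith [norm_nonneg z]
  have h1 := (hf.differentiableAt (isOpen_disc.mem_nhds hm)).hasDerivAt
  have h2 : HasDerivAt (fun z : ℂ => (r : ℂ) * z) (r * 1) z := (hasDerivAt_id z).const_mul _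
  have h3 := (h1.comp z h2).deriv
  rw [Function.comp_def] at h3
  rw [h3]; ring

lemma continuousOn_density {h : ℂ → ℂ} (hh : ContinuousOn h disc) {ζ : ℂ} (hζ : ‖ζ‖ = 1) :
    ContinuousOn (fun z => ‖h z‖ ^ 2 * diskKernel ζ z) disc :=
  (hh.norm.pow 2).mul (continuousOn_diskKernel_right hζ)

lemma density_nonneg (h : ℂ → ℂ) (ζ : ℂ) {z : ℂ} (hz : z ∈ disc) :
    0 ≤ ‖h z‖ ^ 2 * diskKernel ζ z :=
  mul_nonneg (by positivity) (diskKernel_nonneg ζ (by simpa [disc] using (mem_ball.1 hz).le))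

lemma localDirichlet_dilation_le {f : ℂ → ℂ} (hf : DifferentiableOn ℂ f disc) {ζ : ℂ}
    (hζ : ‖ζ‖ = 1) {σ : ℝ} (hσ0 : 0 < σ) (hσ1 : σ < 1) :
    localDirichlet ζ (fun z => f ((σ ^ 2 : ℝ) * z)) ≤ localDirichlet ζ f := by
  have hd : DifferentiableOn ℂ (deriv f) disc := hf.deriv isOpen_disc
  have hr0 : 0 ≤ σ ^ 2 := by positivity
  have hr1 : σ ^ 2 ≤ 1 := by nlinarith
  have hmul : MapsTo (fun z : ℂ => ((σ ^ 2 : ℝ) : ℂ) * z) disc disc := by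
    intro z hz
    simp only [disc, mem_ball, dist_zero_right, norm_mul, Complex.norm_real, Real.norm_eq_abs,
      abs_of_nonneg hr0] at hz ⊢
    nlinarith [norm_nonneg z]
  set h : ℂ → ℂ := fun z => (σ ^ 2 : ℝ) * deriv f z with hh
  have hhd : DifferentiableOn ℂ h disc := hd.const_mul _
  have e1 : localDirichlet ζ (fun z => f ((σ ^ 2 : ℝ) * z)) =
      ∫⁻ z in disc, ENNReal.ofReal (‖h ((σ ^ 2 : ℝ) * z)‖ ^ 2 * diskKernel ζ z) :=
    setLIntegral_congr_fun measurableSet_disc fun z hz => by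
      simp only [deriv_comp_mul hf hr0 hr1 hz, hh]
  rw [e1, localDirichlet, lintegral_disc_eq (F := fun z => ‖h ((σ ^ 2 : ℝ) * z)‖ ^ 2 * diskKernel ζ z)
      (continuousOn_density (h := fun z => h ((σ ^ 2 : ℝ) * z))
        (hhd.continuousOn.comp (by fun_prop) hmul) hζ)
      (fun z hz => density_nonneg (fun z => h ((σ ^ 2 : ℝ) * z)) ζ hz),
    lintegral_disc_eq (continuousOn_density hd.continuousOn hζ)
      (fun z hz => density_nonneg _ ζ hz)]
  set M : ℝ → ℝ := fun ρ => circleAverage (fun z => ‖deriv f z‖ ^ 2 * diskKernel ζ z) 0 ρ with hM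
  have himg : (fun ρ => σ * ρ) '' Ioo (0 : ℝ) 1 ⊆ Ioo 0 1 := by
    rintro _ ⟨ρ, hρ, rfl⟩
    exact ⟨by have := hρ.1; positivity, by nlinarith [hρ.1, hρ.2]⟩
  have e2 := lintegral_image_eq_lintegral_abs_deriv_mul (s := Ioo (0 : ℝ) 1)
    (f := fun ρ => σ * ρ) (f' := fun _ => σ) measurableSet_Ioo
    (fun x _ => by simpa using ((hasDerivAt_id x).const_mul σ).hasDerivWithinAt)
    (fun x _ y _ hxy => by simpa [hσ0.ne'] using hxy)
    (fun ρ => ENNReal.ofReal (2 * Real.pi * ρ * M ρ))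
  refine le_trans ?_ (le_trans e2.ge (lintegral_mono_set himg))
  refine setLIntegral_mono' measurableSet_Ioo fun ρ hρ => ?_
  have hM0 : 0 ≤ M (σ * ρ) := by
    apply Real.circleAverage_nonneg_of_nonneg
    intro z hz
    apply density_nonneg
    have : ‖z‖ = |σ * ρ| := by simpa using hz
    rw [abs_of_pos (by have := hρ.1; positivity)] at this
    simpa [disc, this] using (himg ⟨ρ, hρ, rfl⟩).2
  have key : circleAverage (fun z => ‖h ((σ ^ 2 : ℝ) * z)‖ ^ 2 * diskKernel ζ z) 0 ρ ≤
      σ ^ 4 * M (σ * ρ) := by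
    refine (circleAverage_weighted_dilation_le hhd hζ hρ.1.le hρ.2 hσ0.le hσ1).trans (le_of_eq ?_)
    simp only [hM]
    rw [← smul_eq_mul (σ ^ 4), ← Real.circleAverage_fun_smul]
    congr 1; ext z
    simp only [hh, norm_mul, Complex.norm_real, Real.norm_eq_abs, abs_of_nonneg hr0, smul_eq_mul]
    ring
  rw [abs_of_pos hσ0, ← ENNReal.ofReal_mul hσ0.le]
  apply ENNReal.ofReal_le_ofReal
  have hρ0 := hρ.1
  have h4 : σ ^ 4 ≤ σ ^ 2 := by nlinarith
  calc 2 * Real.pi * ρ * circleAverage _ 0 ρ ≤ 2 * Real.pi * ρ * (σ ^ 4 * M (σ * ρ)) := by gcongr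
    _ ≤ 2 * Real.pi * ρ * (σ ^ 2 * M (σ * ρ)) := by gcongr
    _ = _ := by ring

lemma OnCircle.ae_norm (hμ : OnCircle μ) : ∀ᵐ ζ ∂μ, ‖ζ‖ = 1 := by
  have : ∀ᵐ ζ ∂μ, ζ ∈ circleT := by rwa [ae_iff]
  filter_upwards [this] with ζ hζ
  simpa [circleT] using hζ

lemma poissonMu_eq (μ : Measure ℂ) (z : ℂ) : poissonMu μ z = ∫ ζ, diskKernel ζ z ∂μ := rfl

lemma norm_le_one_of_mem_disc {z : ℂ} (hz : z ∈ disc) : ‖z‖ ≤ 1 := by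
  simpa [disc] using (mem_ball.1 hz).le

lemma norm_lt_one_of_mem_disc {z : ℂ} (hz : z ∈ disc) : ‖z‖ < 1 := by
  simpa [disc] using hz

lemma poissonMu_nonneg (μ : Measure ℂ) {z : ℂ} (hz : z ∈ disc) : 0 ≤ poissonMu μ z :=
  integral_nonneg fun ζ => diskKernel_nonneg ζ (norm_le_one_of_mem_disc hz)

lemma measurable_poissonMu (μ : Measure ℂ) [IsFiniteMeasure μ] : Measurable (poissonMu μ) := by
  have := (measurable_diskKernel.comp measurable_swap).stronglyMeasurable.integral_prod_right'
    (ν := μ)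
  exact this.measurable

lemma integrable_diskKernel [IsFiniteMeasure μ] (hμ : OnCircle μ) {z : ℂ} (hz : z ∈ disc) :
    Integrable (fun ζ => diskKernel ζ z) μ := by
  obtain ⟨C, hC⟩ := (isCompact_sphere (0 : ℂ) 1).exists_bound_of_continuousOn
    (continuousOn_diskKernel_left (norm_lt_one_of_mem_disc hz))
  refine Integrable.of_bound
    (measurable_diskKernel.comp measurable_prodMk_right).aestronglyMeasurable C ?_
  filter_upwards [hμ.ae_norm] with ζ hζ using hC ζ (by simpa using hζ)

lemma ofReal_poissonMu [IsFiniteMeasure μ] (hμ : OnCircle μ) {z : ℂ} (hz : z ∈ disc) :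
    ENNReal.ofReal (poissonMu μ z) = ∫⁻ ζ, ENNReal.ofReal (diskKernel ζ z) ∂μ := by
  rw [poissonMu_eq, ofReal_integral_eq_lintegral_ofReal (integrable_diskKernel hμ hz)]
  exact ae_of_all _ fun ζ => diskKernel_nonneg ζ (norm_le_one_of_mem_disc hz)

/-- Weighted area integrals against `P_μ` are averages of the local ones. -/
lemma lintegral_weight_poissonMu [IsFiniteMeasure μ] (hμ : OnCircle μ) {w : ℂ → ℝ}
    (hw : Measurable w) (hw0 : ∀ z, 0 ≤ w z) :
    ∫⁻ z in disc, ENNReal.ofReal (w z * poissonMu μ z) =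
      ∫⁻ ζ, (∫⁻ z in disc, ENNReal.ofReal (w z * diskKernel ζ z)) ∂μ := by
  rw [← lintegral_lintegral_swap]
  · refine setLIntegral_congr_fun measurableSet_disc fun z hz => ?_
    simp only [ENNReal.ofReal_mul (hw0 z)]
    rw [ofReal_poissonMu hμ hz, lintegral_const_mul]
    exact (measurable_diskKernel.comp measurable_prodMk_right).ennreal_ofReal
  · exact ((hw.comp measurable_fst).mul
      (measurable_diskKernel.comp measurable_swap)).ennreal_ofReal.aemeasurable

lemma integrableOn_weight_iff [IsFiniteMeasure μ] {w : ℂ → ℝ} (hw : Measurable w)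
    (hw0 : ∀ z, 0 ≤ w z) :
    IntegrableOn (fun z => w z * poissonMu μ z) disc ↔
      ∫⁻ z in disc, ENNReal.ofReal (w z * poissonMu μ z) ≠ ⊤ := by
  rw [IntegrableOn, Integrable, hasFiniteIntegral_iff_ofReal, lt_top_iff_ne_top]
  · exact and_iff_right (hw.mul (measurable_poissonMu μ)).aestronglyMeasurable
  · exact (ae_restrict_mem measurableSet_disc).mono
      fun z hz => mul_nonneg (hw0 z) (poissonMu_nonneg μ hz)

lemma integral_weight_eq [IsFiniteMeasure μ] {w : ℂ → ℝ} (hw : Measurable w)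
    (hw0 : ∀ z, 0 ≤ w z) :
    ∫ z in disc, w z * poissonMu μ z =
      (∫⁻ z in disc, ENNReal.ofReal (w z * poissonMu μ z)).toReal := by
  refine integral_eq_lintegral_of_nonneg_ae ?_ (hw.mul (measurable_poissonMu μ)).aestronglyMeasurable
  exact (ae_restrict_mem measurableSet_disc).mono
      fun z hz => mul_nonneg (hw0 z) (poissonMu_nonneg μ hz)

/-- The Dirichlet energy, up to the factor `π`, as an extended nonnegative real. -/
def energy (μ : Measure ℂ) (f : ℂ → ℂ) : ℝ≥0∞ :=
  ∫⁻ z in disc, ENNReal.ofReal (dirichletDensity μ f z)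

lemma measurable_normSq_deriv (f : ℂ → ℂ) : Measurable fun z => ‖deriv f z‖ ^ 2 :=
  (measurable_deriv f).norm.pow_const 2

lemma energy_eq [IsFiniteMeasure μ] (hμ : OnCircle μ) (f : ℂ → ℂ) :
    energy μ f = ∫⁻ ζ, localDirichlet ζ f ∂μ :=
  lintegral_weight_poissonMu hμ (measurable_normSq_deriv f) fun _ => by positivity

lemma integrableOn_dirichletDensity_iff [IsFiniteMeasure μ] (f : ℂ → ℂ) :
    IntegrableOn (dirichletDensity μ f) disc ↔ energy μ f ≠ ⊤ :=
  integrableOn_weight_iff (measurable_normSq_deriv f) fun _ => by positivity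

lemma dirichletIntegral_eq [IsFiniteMeasure μ] (f : ℂ → ℂ) :
    dirichletIntegral μ f = (1 / Real.pi) * (energy μ f).toReal := by
  rw [dirichletIntegral]
  congr 1
  exact integral_weight_eq (measurable_normSq_deriv f) fun _ => by positivity

lemma energy_parallelogram [IsFiniteMeasure μ] {f g : ℂ → ℂ} (hf : DifferentiableOn ℂ f disc)
    (hg : DifferentiableOn ℂ g disc) :
    energy μ (fun z => f z - g z) + energy μ (fun z => f z + g z) =
      2 * energy μ f + 2 * energy μ g := by
  have hm (f : ℂ → ℂ) : Measurable fun z => ENNReal.ofReal (dirichletDensity μ f z) :=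
    ((measurable_normSq_deriv f).mul (measurable_poissonMu μ)).ennreal_ofReal
  unfold energy
  rw [← lintegral_const_mul _ (hm f), ← lintegral_const_mul _ (hm g), ← lintegral_add_left (hm _),
    ← lintegral_add_left ((hm f).const_mul _)]
  refine setLIntegral_congr_fun measurableSet_disc fun z hz => ?_
  have hP := poissonMu_nonneg μ hz
  have hf' := hf.differentiableAt (isOpen_disc.mem_nhds hz)
  have hg' := hg.differentiableAt (isOpen_disc.mem_nhds hz)
  have h2 : (2 : ℝ≥0∞) = ENNReal.ofReal 2 := by simp
  simp only [dirichletDensity]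
  rw [h2, ← ENNReal.ofReal_mul zero_le_two, ← ENNReal.ofReal_mul zero_le_two,
    ← ENNReal.ofReal_add (by positivity) (by positivity),
    ← ENNReal.ofReal_add (by positivity) (by positivity),
    deriv_fun_sub hf' hg', deriv_fun_add hf' hg']
  congr 1
  have := parallelogram_law_with_norm ℝ (deriv f z) (deriv g z)
  linear_combination poissonMu μ z * this

lemma energy_const_mul [IsFiniteMeasure μ] (c : ℂ) {f : ℂ → ℂ} (hf : DifferentiableOn ℂ f disc) :
    energy μ (fun z => c * f z) = ENNReal.ofReal (‖c‖ ^ 2) * energy μ f := by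
  unfold energy
  rw [← lintegral_const_mul]
  · refine setLIntegral_congr_fun measurableSet_disc fun z hz => ?_
    simp only [dirichletDensity]
    rw [← ENNReal.ofReal_mul (by positivity), deriv_const_mul, norm_mul]
    · congr 1; ring
    · exact hf.differentiableAt (isOpen_disc.mem_nhds hz)
  · exact ((measurable_normSq_deriv f).mul (measurable_poissonMu μ)).ennreal_ofReal

/-- Mean squares over circles. -/
def meanSq (f : ℂ → ℂ) (r : ℝ) : ℝ := circleAverage (fun z => ‖f z‖ ^ 2) 0 r

lemma hardySet_eq (f : ℂ → ℂ) : hardySet f = {x | ∃ r : ℝ, 0 < r ∧ r < 1 ∧ x = meanSq f r} := by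
  simp [hardySet, meanSq, Real.circleAverage_def, mul_bpt]

lemma meanSq_nonneg (f : ℂ → ℂ) (r : ℝ) : 0 ≤ meanSq f r :=
  Real.circleAverage_nonneg_of_nonneg fun _ _ => by positivity

lemma hardyNormSq_nonneg (f : ℂ → ℂ) : 0 ≤ hardyNormSq f := by
  apply Real.sSup_nonneg
  rw [hardySet_eq]
  rintro _ ⟨r, -, -, rfl⟩
  exact meanSq_nonneg f r

lemma meanSq_le_hardyNormSq {f : ℂ → ℂ} (hf : BddAbove (hardySet f)) {r : ℝ} (h0 : 0 < r)
    (h1 : r < 1) : meanSq f r ≤ hardyNormSq f :=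
  le_csSup hf (by rw [hardySet_eq]; exact ⟨r, h0, h1, rfl⟩)

lemma bddAbove_hardySet {f : ℂ → ℂ} {C : ℝ} (h : ∀ r, 0 < r → r < 1 → meanSq f r ≤ C) :
    BddAbove (hardySet f) := by
  refine ⟨C, ?_⟩
  rw [hardySet_eq]
  rintro _ ⟨r, h0, h1, rfl⟩
  exact h r h0 h1

lemma hardyNormSq_le {f : ℂ → ℂ} {C : ℝ} (h : ∀ r, 0 < r → r < 1 → meanSq f r ≤ C) :
    hardyNormSq f ≤ C := by
  refine csSup_le ?_ ?_
  · rw [hardySet_eq]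
    exact ⟨_, 1 / 2, by norm_num, by norm_num, rfl⟩
  · rw [hardySet_eq]
    rintro _ ⟨r, h0, h1, rfl⟩
    exact h r h0 h1

lemma sphere_subset_disc {r : ℝ} (h0 : 0 ≤ r) (h1 : r < 1) : sphere (0 : ℂ) |r| ⊆ disc := by
  rw [abs_of_nonneg h0]
  exact sphere_subset_closedBall.trans (closedBall_subset_ball h1)

lemma circleIntegrable_of_continuousOn_disc {E : Type*} [NormedAddCommGroup E] {f : ℂ → E}
    (hf : ContinuousOn f disc) {r : ℝ} (h0 : 0 ≤ r) (h1 : r < 1) : CircleIntegrable f 0 r := by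
  apply ContinuousOn.circleIntegrable'
  exact hf.mono (sphere_subset_disc h0 h1)

lemma meanSq_parallelogram {f g : ℂ → ℂ} (hf : ContinuousOn f disc) (hg : ContinuousOn g disc)
    {r : ℝ} (h0 : 0 ≤ r) (h1 : r < 1) :
    meanSq (fun z => f z - g z) r + meanSq (fun z => f z + g z) r =
      2 * meanSq f r + 2 * meanSq g r := by
  have hi {f : ℂ → ℂ} (hf : ContinuousOn f disc) : CircleIntegrable (fun z => ‖f z‖ ^ 2) 0 r :=
    circleIntegrable_of_continuousOn_disc (hf.norm.pow 2) h0 h1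
  unfold meanSq
  rw [← Real.circleAverage_fun_add (hi (f := fun z => f z - g z) (hf.sub hg))
      (hi (f := fun z => f z + g z) (hf.add hg)), ← smul_eq_mul,
    ← smul_eq_mul (2 : ℝ), ← Real.circleAverage_fun_smul, ← Real.circleAverage_fun_smul,
    ← Real.circleAverage_fun_add (f₁ := fun z => (2 : ℝ) • ‖f z‖ ^ 2)
      (f₂ := fun z => (2 : ℝ) • ‖g z‖ ^ 2) ((hi hf).const_smul) ((hi hg).const_smul)]
  congr 1
  ext z
  have := parallelogram_law_with_norm ℝ (f z) (g z)
  simp only [smul_eq_mul]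
  linarith

lemma meanSq_const_mul (c : ℂ) (f : ℂ → ℂ) (r : ℝ) :
    meanSq (fun z => c * f z) r = ‖c‖ ^ 2 * meanSq f r := by
  unfold meanSq
  rw [← smul_eq_mul (‖c‖ ^ 2), ← Real.circleAverage_fun_smul]
  congr 1; ext z; simp [mul_pow]

lemma memD_iff [IsFiniteMeasure μ] {f : ℂ → ℂ} :
    MemD μ f ↔ DifferentiableOn ℂ f disc ∧ BddAbove (hardySet f) ∧ energy μ f ≠ ⊤ := by
  rw [MemD, MemHardy2, integrableOn_dirichletDensity_iff, and_assoc]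

lemma dNormSq_eq [IsFiniteMeasure μ] (f : ℂ → ℂ) :
    dNormSq μ f = hardyNormSq f + (1 / Real.pi) * (energy μ f).toReal := by
  rw [dNormSq, dirichletIntegral_eq]

lemma dNormSq_nonneg [IsFiniteMeasure μ] (f : ℂ → ℂ) : 0 ≤ dNormSq μ f := by
  rw [dNormSq_eq]
  have := hardyNormSq_nonneg f
  positivity

lemma MemD.sub_add [IsFiniteMeasure μ] {f g : ℂ → ℂ} (hf : MemD μ f) (hg : MemD μ g) :
    (MemD μ (fun z => f z - g z) ∧ dNormSq μ (fun z => f z - g z) ≤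
      2 * dNormSq μ f + 2 * dNormSq μ g) ∧
    (MemD μ (fun z => f z + g z) ∧ dNormSq μ (fun z => f z + g z) ≤
      2 * dNormSq μ f + 2 * dNormSq μ g) := by
  rw [memD_iff] at hf hg
  obtain ⟨hf, hfb, hfe⟩ := hf
  obtain ⟨hg, hgb, hge⟩ := hg
  have hE := energy_parallelogram (μ := μ) hf hg
  have hM : ∀ r, 0 < r → r < 1 → meanSq (fun z => f z - g z) r + meanSq (fun z => f z + g z) r ≤
      2 * hardyNormSq f + 2 * hardyNormSq g := by
    intro r h0 h1
    rw [meanSq_parallelogram hf.continuousOn hg.continuousOn h0.le h1]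
    linarith [meanSq_le_hardyNormSq hfb h0 h1, meanSq_le_hardyNormSq hgb h0 h1]
  have hM1 : ∀ r, 0 < r → r < 1 → meanSq (fun z => f z - g z) r ≤
      2 * hardyNormSq f + 2 * hardyNormSq g := fun r h0 h1 => by
    linarith [hM r h0 h1, meanSq_nonneg (fun z => f z + g z) r]
  have hM2 : ∀ r, 0 < r → r < 1 → meanSq (fun z => f z + g z) r ≤
      2 * hardyNormSq f + 2 * hardyNormSq g := fun r h0 h1 => by
    linarith [hM r h0 h1, meanSq_nonneg (fun z => f z - g z) r]
  have hfin : 2 * energy μ f + 2 * energy μ g ≠ ⊤ := by finiteness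
  have hE1 : energy μ (fun z => f z - g z) ≤ 2 * energy μ f + 2 * energy μ g :=
    hE ▸ le_self_add
  have hE2 : energy μ (fun z => f z + g z) ≤ 2 * energy μ f + 2 * energy μ g :=
    hE ▸ le_add_self
  have ht : (2 * energy μ f + 2 * energy μ g).toReal =
      2 * (energy μ f).toReal + 2 * (energy μ g).toReal := by
    rw [ENNReal.toReal_add (by finiteness) (by finiteness)]; simp
  have h1 := ENNReal.toReal_mono hfin hE1
  have h2 := ENNReal.toReal_mono hfin hE2
  rw [ht] at h1 h2
  have hπ : 0 ≤ 1 / Real.pi := by positivity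
  refine ⟨⟨memD_iff.2 ⟨hf.sub hg, bddAbove_hardySet hM1, ne_top_of_le_ne_top hfin hE1⟩, ?_⟩,
    ⟨memD_iff.2 ⟨hf.add hg, bddAbove_hardySet hM2, ne_top_of_le_ne_top hfin hE2⟩, ?_⟩⟩
  · rw [dNormSq_eq, dNormSq_eq, dNormSq_eq]
    nlinarith [hardyNormSq_le hM1, mul_le_mul_of_nonneg_left h1 hπ]
  · rw [dNormSq_eq, dNormSq_eq, dNormSq_eq]
    nlinarith [hardyNormSq_le hM2, mul_le_mul_of_nonneg_left h2 hπ]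

lemma MemD.const_mul [IsFiniteMeasure μ] {f : ℂ → ℂ} (hf : MemD μ f) (c : ℂ) :
    MemD μ (fun z => c * f z) ∧ dNormSq μ (fun z => c * f z) ≤ ‖c‖ ^ 2 * dNormSq μ f := by
  rw [memD_iff] at hf
  obtain ⟨hf, hfb, hfe⟩ := hf
  have hM : ∀ r, 0 < r → r < 1 → meanSq (fun z => c * f z) r ≤ ‖c‖ ^ 2 * hardyNormSq f := by
    intro r h0 h1
    rw [meanSq_const_mul]
    gcongr
    exact meanSq_le_hardyNormSq hfb h0 h1
  have hE := energy_const_mul (μ := μ) c hf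
  refine ⟨memD_iff.2 ⟨hf.const_mul c, bddAbove_hardySet hM, by rw [hE]; finiteness⟩, ?_⟩
  rw [dNormSq_eq, dNormSq_eq, hE, ENNReal.toReal_mul, ENNReal.toReal_ofReal (by positivity)]
  linarith [hardyNormSq_le hM]

lemma mul_mem_disc {r : ℝ} (hr0 : 0 ≤ r) (hr1 : r ≤ 1) {z : ℂ} (hz : z ∈ disc) :
    (r : ℂ) * z ∈ disc := by
  simp only [disc, mem_ball, dist_zero_right, norm_mul, Complex.norm_real, Real.norm_eq_abs,
    abs_of_nonneg hr0] at hz ⊢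
  nlinarith [norm_nonneg z]

lemma differentiableOn_comp_mul {f : ℂ → ℂ} (hf : DifferentiableOn ℂ f disc) {r : ℝ}
    (hr0 : 0 ≤ r) (hr1 : r ≤ 1) : DifferentiableOn ℂ (fun z => f (r * z)) disc :=
  hf.comp (by fun_prop) fun _ hz => mul_mem_disc hr0 hr1 hz

lemma energy_dilation_le [IsFiniteMeasure μ] (hμ : OnCircle μ) {f : ℂ → ℂ}
    (hf : DifferentiableOn ℂ f disc) {σ : ℝ} (hσ0 : 0 < σ) (hσ1 : σ < 1) :
    energy μ (fun z => f ((σ ^ 2 : ℝ) * z)) ≤ energy μ f := by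
  rw [energy_eq hμ, energy_eq hμ]
  refine lintegral_mono_ae ?_
  filter_upwards [hμ.ae_norm] with ζ hζ using localDirichlet_dilation_le hf hζ hσ0 hσ1

lemma MemD.dilation [IsFiniteMeasure μ] (hμ : OnCircle μ) {f : ℂ → ℂ} (hf : MemD μ f) {σ : ℝ}
    (hσ0 : 0 < σ) (hσ1 : σ < 1) :
    MemD μ (fun z => f ((σ ^ 2 : ℝ) * z)) ∧
      dNormSq μ (fun z => f ((σ ^ 2 : ℝ) * z)) ≤ dNormSq μ f := by
  rw [memD_iff] at hf
  obtain ⟨hf, hfb, hfe⟩ := hf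
  have hσ2 : σ ^ 2 ≤ 1 := by nlinarith
  have hM : ∀ r, 0 < r → r < 1 → meanSq (fun z => f ((σ ^ 2 : ℝ) * z)) r ≤ hardyNormSq f :=
    fun r h0 h1 => (circleAverage_norm_sq_dilation_le hf h0.le h1 (by positivity) hσ2).trans
      (meanSq_le_hardyNormSq hfb h0 h1)
  have hE := energy_dilation_le hμ hf hσ0 hσ1
  refine ⟨memD_iff.2 ⟨differentiableOn_comp_mul hf (by positivity) hσ2, bddAbove_hardySet hM,
    ne_top_of_le_ne_top hfe hE⟩, ?_⟩
  rw [dNormSq_eq, dNormSq_eq]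
  have := ENNReal.toReal_mono hfe hE
  gcongr
  exact hardyNormSq_le hM

/-- A sequence in `(0, 1)` increasing to `1`. -/
def sig (n : ℕ) : ℝ := 1 - 1 / ((n : ℝ) + 2)

lemma sig_pos (n : ℕ) : 0 < sig n := by
  have : 1 / ((n : ℝ) + 2) < 1 := by
    rw [div_lt_one (by positivity)]; linarith [(Nat.cast_nonneg n : (0 : ℝ) ≤ n)]
  unfold sig; linarith

lemma sig_lt_one (n : ℕ) : sig n < 1 := by
  have : 0 < 1 / ((n : ℝ) + 2) := by positivity
  unfold sig; linarith

lemma tendsto_sig_sq : Tendsto (fun n => sig n ^ 2) atTop (𝓝 1) := by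
  have h : Tendsto (fun n : ℕ => (n : ℝ) + 2) atTop atTop :=
    tendsto_atTop_add_const_right _ _ tendsto_natCast_atTop_atTop
  have := ((tendsto_const_nhds (x := (1 : ℝ))).sub (h.const_div_atTop 1)).pow 2
  simpa [sig] using this

lemma tendsto_sig_mul (z : ℂ) : Tendsto (fun n => ((sig n ^ 2 : ℝ) : ℂ) * z) atTop (𝓝 z) := by
  have := ((Complex.continuous_ofReal.tendsto 1).comp tendsto_sig_sq).mul_const z
  simpa [Function.comp_def] using this

lemma tendsto_comp_sig_mul {f : ℂ → ℂ} (hf : ContinuousOn f disc) {z : ℂ} (hz : z ∈ disc) :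
    Tendsto (fun n => f ((sig n ^ 2 : ℝ) * z)) atTop (𝓝 (f z)) :=
  ((hf.continuousAt (isOpen_disc.mem_nhds hz)).tendsto).comp (tendsto_sig_mul z)

lemma sig_sq_nonneg (n : ℕ) : 0 ≤ sig n ^ 2 := by positivity

lemma sig_sq_le (n : ℕ) : sig n ^ 2 ≤ 1 := by nlinarith [sig_pos n, sig_lt_one n]

lemma measurable_ofReal_density [IsFiniteMeasure μ] (f : ℂ → ℂ) :
    Measurable fun z => ENNReal.ofReal (dirichletDensity μ f z) :=
  ((measurable_normSq_deriv f).mul (measurable_poissonMu μ)).ennreal_ofReal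

lemma eventually_energy_sub_dilation_lt [IsFiniteMeasure μ] (hμ : OnCircle μ) {g : ℂ → ℂ}
    (hg : MemD μ g) {ε : ℝ≥0∞} (hε : 0 < ε) :
    ∀ᶠ n in atTop, energy μ (fun z => g z - g ((sig n ^ 2 : ℝ) * z)) < ε := by
  rw [memD_iff] at hg
  obtain ⟨hg, -, hge⟩ := hg
  have hd (n : ℕ) := differentiableOn_comp_mul hg (sig_sq_nonneg n) (sig_sq_le n)
  have hsum (n : ℕ) : energy μ (fun z => g z - g ((sig n ^ 2 : ℝ) * z)) +
      energy μ (fun z => g z + g ((sig n ^ 2 : ℝ) * z)) ≤ 4 * energy μ g := by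
    rw [energy_parallelogram hg (hd n)]
    calc _ ≤ 2 * energy μ g + 2 * energy μ g := by
          gcongr; exact energy_dilation_le hμ hg (sig_pos n) (sig_lt_one n)
      _ = _ := by ring
  have hlim : 4 * energy μ g ≤
      liminf (fun n => energy μ (fun z => g z + g ((sig n ^ 2 : ℝ) * z))) atTop := by
    refine le_trans ?_ (lintegral_liminf_le fun n => measurable_ofReal_density _)
    rw [energy, ← lintegral_const_mul _ (measurable_ofReal_density g)]
    refine setLIntegral_mono' measurableSet_disc fun z hz => ?_
    have hP := poissonMu_nonneg μ hz
    have hg' := hg.differentiableAt (isOpen_disc.mem_nhds hz)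
    have ht : Tendsto (fun n => ENNReal.ofReal (dirichletDensity μ
        (fun z => g z + g ((sig n ^ 2 : ℝ) * z)) z)) atTop
        (𝓝 (ENNReal.ofReal (‖deriv g z + 1 * deriv g z‖ ^ 2 * poissonMu μ z))) := by
      have : ∀ n, dirichletDensity μ (fun z => g z + g ((sig n ^ 2 : ℝ) * z)) z =
          ‖deriv g z + (sig n ^ 2 : ℝ) * deriv g ((sig n ^ 2 : ℝ) * z)‖ ^ 2 * poissonMu μ z := by
        intro n
        rw [dirichletDensity, deriv_fun_add hg' ((hd n).differentiableAt (isOpen_disc.mem_nhds hz)),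
          deriv_comp_mul hg (sig_sq_nonneg n) (sig_sq_le n) hz]
      simp only [this]
      refine ENNReal.tendsto_ofReal (Tendsto.mul_const _ ((Tendsto.norm ?_).pow 2))
      refine tendsto_const_nhds.add (Tendsto.mul ?_
        (tendsto_comp_sig_mul (hg.deriv isOpen_disc).continuousOn hz))
      simpa using tendsto_sig_mul 1
    rw [ht.liminf_eq, dirichletDensity, one_mul, ← two_mul, norm_mul, mul_pow]
    have : (4 : ℝ≥0∞) = ENNReal.ofReal (‖(2 : ℂ)‖ ^ 2) := by
      norm_num
    rw [this, ← ENNReal.ofReal_mul (by positivity), mul_assoc]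
  have hfin : 4 * energy μ g ≠ ⊤ := by finiteness
  by_cases h0 : 4 * energy μ g = 0
  · filter_upwards with n
    refine lt_of_le_of_lt ((le_self_add.trans (hsum n)).trans h0.le) hε
  · filter_upwards [eventually_lt_of_lt_liminf
      ((ENNReal.sub_lt_self hfin h0 hε.ne').trans_le hlim)] with n hn
    by_contra! hc
    refine absurd hn (not_lt.2 ?_)
    refine ENNReal.le_sub_of_add_le_right (ne_top_of_le_ne_top hfin (hc.trans
      (le_self_add.trans (hsum n)))) ?_
    rw [add_comm]
    exact (add_le_add_left hc _).trans (hsum n)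

lemma tendsto_meanSq_add_dilation {g : ℂ → ℂ} (hg : DifferentiableOn ℂ g disc) {ρ : ℝ}
    (h0 : 0 ≤ ρ) (h1 : ρ < 1) :
    Tendsto (fun n => meanSq (fun z => g z + g ((sig n ^ 2 : ℝ) * z)) ρ) atTop
      (𝓝 (4 * meanSq g ρ)) := by
  have hK := (isCompact_closedBall (0 : ℂ) ρ).exists_bound_of_continuousOn
    (hg.continuousOn.mono (closedBall_subset_ball h1))
  obtain ⟨K, hK⟩ := hK
  have h4 : 4 * meanSq g ρ = meanSq (fun z => g z + g z) ρ := by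
    have : (fun z => g z + g z) = fun z => 2 * g z := by ext z; ring
    rw [this, meanSq_const_mul]; norm_num
  rw [h4]
  simp only [meanSq, Real.circleAverage_def]
  refine Tendsto.const_smul (intervalIntegral.tendsto_integral_filter_of_dominated_convergence
    (fun _ => (K + K) ^ 2) ?_ ?_ (by simp) ?_) _
  · refine Eventually.of_forall fun n => Continuous.aestronglyMeasurable ?_
    exact ((hg.add (differentiableOn_comp_mul hg (sig_sq_nonneg n)
      (sig_sq_le n))).continuousOn.norm.pow 2).comp_continuous (by fun_prop)
      (circleMap_mem_disc h0 h1)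
  · refine Eventually.of_forall fun n => ae_of_all _ fun θ _ => ?_
    have hn : ‖circleMap 0 ρ θ‖ = ρ := by simp [abs_of_nonneg h0]
    have k1 : ‖g (circleMap 0 ρ θ)‖ ≤ K := hK _ (by simp [hn])
    have k2 : ‖g ((sig n ^ 2 : ℝ) * circleMap 0 ρ θ)‖ ≤ K := by
      refine hK _ ?_
      rw [mem_closedBall, dist_zero_right, norm_mul, hn, Complex.norm_real, Real.norm_eq_abs,
        abs_of_nonneg (sig_sq_nonneg n)]
      nlinarith [sig_sq_le n]
    rw [norm_pow, norm_norm]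
    gcongr
    exact (norm_add_le _ _).trans (add_le_add k1 k2)
  · refine ae_of_all _ fun θ _ => ?_
    exact ((tendsto_const_nhds.add (tendsto_comp_sig_mul hg.continuousOn
      (circleMap_mem_disc h0 h1 θ))).norm.pow 2)

lemma eventually_hardyNormSq_sub_dilation_lt {g : ℂ → ℂ} (hg : DifferentiableOn ℂ g disc)
    (hb : BddAbove (hardySet g)) {ε : ℝ} (hε : 0 < ε) :
    ∀ᶠ n in atTop, hardyNormSq (fun z => g z - g ((sig n ^ 2 : ℝ) * z)) ≤ ε := by
  obtain ⟨ρ, h0, h1, hρ⟩ : ∃ ρ, 0 < ρ ∧ ρ < 1 ∧ hardyNormSq g - ε / 8 < meanSq g ρ := by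
    have hne : (hardySet g).Nonempty := by
      rw [hardySet_eq]; exact ⟨_, 1 / 2, by norm_num, by norm_num, rfl⟩
    obtain ⟨x, hx, hlt⟩ := exists_lt_of_lt_csSup hne
      (show hardyNormSq g - ε / 8 < sSup (hardySet g) by rw [hardyNormSq]; linarith)
    rw [hardySet_eq] at hx
    obtain ⟨ρ, h0, h1, rfl⟩ := hx
    exact ⟨ρ, h0, h1, hlt⟩
  filter_upwards [(tendsto_meanSq_add_dilation hg h0.le h1).eventually
    (lt_mem_nhds (show 4 * meanSq g ρ - ε / 2 < _ by linarith))] with n hn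
  have hd := differentiableOn_comp_mul hg (sig_sq_nonneg n) (sig_sq_le n)
  have hbig : ∀ r, ρ ≤ r → r < 1 → meanSq (fun z => g z - g ((sig n ^ 2 : ℝ) * z)) r ≤ ε := by
    intro r hr hr1
    have hr0 := h0.trans_le hr
    have e1 := meanSq_parallelogram hg.continuousOn hd.continuousOn hr0.le hr1
    have e2 := meanSq_le_hardyNormSq hb hr0 hr1
    have e3 : meanSq (fun z => g ((sig n ^ 2 : ℝ) * z)) r ≤ meanSq g r :=
      circleAverage_norm_sq_dilation_le hg hr0.le hr1 (sig_sq_nonneg n) (sig_sq_le n)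
    have e4 : meanSq (fun z => g z + g ((sig n ^ 2 : ℝ) * z)) ρ ≤
        meanSq (fun z => g z + g ((sig n ^ 2 : ℝ) * z)) r :=
      circleAverage_norm_sq_mono (hg.add hd) h0.le hr hr1
    linarith
  refine hardyNormSq_le fun r hr0 hr1 => ?_
  rcases le_total ρ r with h | h
  · exact hbig r h hr1
  · exact (circleAverage_norm_sq_mono (hg.sub hd) hr0.le h h1).trans (hbig ρ le_rfl h1)

lemma eventually_dNormSq_sub_dilation_lt [IsFiniteMeasure μ] (hμ : OnCircle μ) {g : ℂ → ℂ}
    (hg : MemD μ g) {ε : ℝ} (hε : 0 < ε) :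
    ∀ᶠ n in atTop, dNormSq μ (fun z => g z - g ((sig n ^ 2 : ℝ) * z)) < ε := by
  have hε' : (0 : ℝ≥0∞) < ENNReal.ofReal (Real.pi * (ε / 2)) := by
    rw [ENNReal.ofReal_pos]; positivity
  filter_upwards [eventually_energy_sub_dilation_lt hμ hg hε',
    eventually_hardyNormSq_sub_dilation_lt hg.1.1 hg.1.2 (show 0 < ε / 3 by positivity)] with n h1 h2
  rw [dNormSq_eq]
  have := (ENNReal.toReal_mono ENNReal.ofReal_ne_top h1.le)
  rw [ENNReal.toReal_ofReal (by positivity)] at this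
  calc _ ≤ ε / 3 + 1 / Real.pi * (Real.pi * (ε / 2)) := by gcongr
    _ = ε / 3 + ε / 2 := by field_simp
    _ < ε := by linarith

lemma exists_polynomial_approx {G : ℂ → ℂ} {R : ℝ} (hR : 1 < R)
    (hG : DifferentiableOn ℂ G (ball 0 R)) {ε : ℝ} (hε : 0 < ε) :
    ∃ p : Polynomial ℂ, ∀ z ∈ closedBall (0 : ℂ) 1,
      ‖G z - p.eval z‖ < ε ∧ ‖deriv G z - deriv (fun z => p.eval z) z‖ < ε := by
  obtain ⟨S, hS1, hSR⟩ := exists_between hR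
  have hS0 : 0 < S := by linarith
  lift S to NNReal using hS0.le
  have hp := (hG.mono (closedBall_subset_ball hSR)).hasFPowerSeriesOnBall (by exact_mod_cast hS0)
  have hball : Metric.eball (0 : ℂ) S = ball 0 S := Metric.eball_coe
  have hl := hp.tendstoLocallyUniformlyOn
  rw [hball] at hl
  set q : ℕ → Polynomial ℂ := fun n => ∑ i ∈ Finset.range n,
    Polynomial.C ((cauchyPowerSeries G 0 S).coeff i) * Polynomial.X ^ i with hq
  have hqe : (fun n y => (cauchyPowerSeries G 0 S).partialSum n y) =
      fun n y => (q n).eval y := by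
    ext n y
    simp only [hq, FormalMultilinearSeries.partialSum, Polynomial.eval_finsetSum,
      FormalMultilinearSeries.apply_eq_pow_smul_coeff, Polynomial.eval_mul, Polynomial.eval_C,
      Polynomial.eval_pow, Polynomial.eval_X, smul_eq_mul, mul_comm]
  simp only [zero_add] at hl
  replace hl : TendstoLocallyUniformlyOn (fun n y => (q n).eval y) G atTop (ball 0 S) := by
    rw [← hqe]; simpa using hl
  have hd := hl.deriv (Eventually.of_forall fun n => (q n).differentiable.differentiableOn)
    isOpen_ball
  have hsub : closedBall (0 : ℂ) 1 ⊆ ball 0 S := closedBall_subset_ball hS1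
  have hc := isCompact_closedBall (0 : ℂ) 1
  have u1 := (tendstoLocallyUniformlyOn_iff_tendstoUniformlyOn_of_compact hc).1 (hl.mono hsub)
  have u2 := (tendstoLocallyUniformlyOn_iff_tendstoUniformlyOn_of_compact hc).1 (hd.mono hsub)
  rw [Metric.tendstoUniformlyOn_iff] at u1 u2
  obtain ⟨n, h1, h2⟩ := ((u1 ε hε).and (u2 ε hε)).exists
  refine ⟨q n, fun z hz => ⟨?_, ?_⟩⟩
  · simpa [dist_eq_norm] using h1 z hz
  · simpa [dist_eq_norm, Function.comp_def] using h2 z hz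

lemma circleAverage_diskKernel {ζ : ℂ} (hζ : ‖ζ‖ = 1) {ρ : ℝ} (h0 : 0 ≤ ρ) (h1 : ρ < 1) :
    circleAverage (diskKernel ζ) 0 ρ = 1 := by
  rw [circleAverage_ofReal_radius]
  have := circleAverage_diskKernel_mul_re (f := fun _ => 1) diffContOnCl_const (w := ρ * ζ)
    (by simp [hζ, abs_of_nonneg h0, h1])
  rw [Complex.one_re] at this
  refine Eq.trans ?_ this
  apply Real.circleAverage_congr_sphere
  intro w hw
  simp only [abs_one, mem_sphere_iff_norm, sub_zero] at hw
  simp [diskKernel_swap hζ hw]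

lemma lintegral_ofReal_Ioo {F : ℝ → ℝ} (hF : Continuous F) (h0 : ∀ ρ ∈ Ioo (0 : ℝ) 1, 0 ≤ F ρ) :
    ∫⁻ ρ in Ioo (0 : ℝ) 1, ENNReal.ofReal (F ρ) = ENNReal.ofReal (∫ ρ in (0 : ℝ)..1, F ρ) := by
  rw [← ofReal_integral_eq_lintegral_ofReal, ← integral_Ioc_eq_integral_Ioo,
    ← intervalIntegral.integral_of_le zero_le_one]
  · exact (hF.continuousOn.integrableOn_compact isCompact_Icc).mono_set Ioo_subset_Icc_self
  · exact (ae_restrict_mem measurableSet_Ioo).mono h0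

lemma lintegral_diskKernel {ζ : ℂ} (hζ : ‖ζ‖ = 1) :
    ∫⁻ z in disc, ENNReal.ofReal (diskKernel ζ z) = ENNReal.ofReal Real.pi := by
  rw [lintegral_disc_eq (continuousOn_diskKernel_right hζ)
    fun z hz => diskKernel_nonneg ζ (norm_le_one_of_mem_disc hz)]
  have : ∫⁻ ρ in Ioo (0 : ℝ) 1, ENNReal.ofReal (2 * Real.pi * ρ * circleAverage (diskKernel ζ) 0 ρ) =
      ∫⁻ ρ in Ioo (0 : ℝ) 1, ENNReal.ofReal (2 * Real.pi * ρ) :=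
    setLIntegral_congr_fun measurableSet_Ioo fun ρ hρ => by
      simp only [circleAverage_diskKernel hζ hρ.1.le hρ.2, mul_one]
  rw [this, lintegral_ofReal_Ioo (by fun_prop)
    fun ρ hρ => mul_nonneg (by positivity) hρ.1.le]
  congr 1
  rw [intervalIntegral.integral_const_mul, integral_id]; ring

lemma memD_of_bound [IsFiniteMeasure μ] (hμ : OnCircle μ) {f : ℂ → ℂ}
    (hf : DifferentiableOn ℂ f disc) {δ : ℝ} (hf0 : ∀ z ∈ disc, ‖f z‖ ≤ δ)
    (hf1 : ∀ z ∈ disc, ‖deriv f z‖ ≤ δ) :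
    MemD μ f ∧ dNormSq μ f ≤ δ ^ 2 * (1 + μ.real univ) := by
  have hM : ∀ r, 0 < r → r < 1 → meanSq f r ≤ δ ^ 2 := by
    intro r h0 h1
    refine Real.circleAverage_mono_on_of_le_circle
      (circleIntegrable_of_continuousOn_disc (hf.continuousOn.norm.pow 2) h0.le h1) ?_
    intro z hz
    have := hf0 z (sphere_subset_disc h0.le h1 hz)
    gcongr
  have hE : energy μ f ≤ ENNReal.ofReal (δ ^ 2 * Real.pi) * μ univ := by
    rw [energy_eq hμ]
    calc ∫⁻ ζ, localDirichlet ζ f ∂μ ≤ ∫⁻ _, ENNReal.ofReal (δ ^ 2 * Real.pi) ∂μ := by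
          refine lintegral_mono_ae ?_
          filter_upwards [hμ.ae_norm] with ζ hζ
          rw [ENNReal.ofReal_mul (by positivity), ← lintegral_diskKernel hζ, localDirichlet,
            ← lintegral_const_mul]
          · refine setLIntegral_mono' measurableSet_disc fun z hz => ?_
            rw [← ENNReal.ofReal_mul (by positivity)]
            have := diskKernel_nonneg ζ (norm_le_one_of_mem_disc hz)
            have := hf1 z hz
            gcongr
          · exact (measurable_diskKernel.comp measurable_prodMk_left).ennreal_ofReal
      _ = _ := by simp
  have hfin : ENNReal.ofReal (δ ^ 2 * Real.pi) * μ univ ≠ ⊤ := by finiteness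
  refine ⟨memD_iff.2 ⟨hf, bddAbove_hardySet hM, ne_top_of_le_ne_top hfin hE⟩, ?_⟩
  rw [dNormSq_eq]
  have h2 := ENNReal.toReal_mono hfin hE
  rw [ENNReal.toReal_mul, ENNReal.toReal_ofReal (by positivity)] at h2
  calc _ ≤ δ ^ 2 + 1 / Real.pi * (δ ^ 2 * Real.pi * (μ univ).toReal) := by
        gcongr; exact hardyNormSq_le hM
    _ = _ := by rw [Measure.real]; field_simp

lemma memD_of_differentiable [IsFiniteMeasure μ] (hμ : OnCircle μ) {f : ℂ → ℂ}
    (hf : Differentiable ℂ f) : MemD μ f := by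
  have hf' : Differentiable ℂ (deriv f) := fun z =>
    (hf.differentiableOn.deriv isOpen_univ).differentiableAt univ_mem
  obtain ⟨A, hA⟩ := (isCompact_closedBall (0 : ℂ) 1).exists_bound_of_continuousOn
    hf.continuous.continuousOn
  obtain ⟨B, hB⟩ := (isCompact_closedBall (0 : ℂ) 1).exists_bound_of_continuousOn
    hf'.continuous.continuousOn
  exact (memD_of_bound hμ hf.differentiableOn (δ := max A B)
    (fun z hz => (hA z (ball_subset_closedBall hz)).trans (le_max_left _ _))
    (fun z hz => (hB z (ball_subset_closedBall hz)).trans (le_max_right _ _))).1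

lemma memD_polynomial [IsFiniteMeasure μ] (hμ : OnCircle μ) (p : Polynomial ℂ) :
    MemD μ (fun z => p.eval z) := memD_of_differentiable hμ p.differentiable

/-- A dilation of `g ∈ D(μ)` is approximated by polynomials, in `D(μ)` and uniformly. -/
lemma exists_polynomial_dilation_approx [IsFiniteMeasure μ] (hμ : OnCircle μ) {g : ℂ → ℂ}
    (hg : DifferentiableOn ℂ g disc) (n : ℕ) {ε : ℝ} (hε : 0 < ε) :
    ∃ p : Polynomial ℂ, (∀ z ∈ closedBall (0 : ℂ) 1,
        ‖g ((sig n ^ 2 : ℝ) * z) - p.eval z‖ < ε) ∧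
      MemD μ (fun z => g ((sig n ^ 2 : ℝ) * z) - p.eval z) ∧
      dNormSq μ (fun z => g ((sig n ^ 2 : ℝ) * z) - p.eval z) < ε := by
  have h0 : 0 < sig n ^ 2 := pow_pos (sig_pos n) 2
  have hlt : sig n ^ 2 < 1 := by nlinarith [sig_pos n, sig_lt_one n]
  have hR : 1 < (sig n ^ 2)⁻¹ := (one_lt_inv₀ h0).2 hlt
  have hG : DifferentiableOn ℂ (fun z => g ((sig n ^ 2 : ℝ) * z)) (ball 0 (sig n ^ 2)⁻¹) := by
    refine hg.comp (by fun_prop) fun z hz => ?_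
    rw [mem_ball, dist_zero_right] at hz
    rw [disc, mem_ball, dist_zero_right, norm_mul, Complex.norm_real, Real.norm_eq_abs,
      abs_of_pos h0]
    calc sig n ^ 2 * ‖z‖ < sig n ^ 2 * (sig n ^ 2)⁻¹ := by gcongr
      _ = 1 := mul_inv_cancel₀ h0.ne'
  set δ := min ε (Real.sqrt (ε / (2 * (1 + μ.real univ)))) with hδ
  have hpos : 0 < 1 + μ.real univ := by positivity
  have hδ0 : 0 < δ := lt_min hε (Real.sqrt_pos.2 (by positivity))
  obtain ⟨p, hp⟩ := exists_polynomial_approx hR hG hδ0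
  have hd := differentiableOn_comp_mul hg (sig_sq_nonneg n) (sig_sq_le n)
  have := memD_of_bound hμ (f := fun z => g ((sig n ^ 2 : ℝ) * z) - p.eval z)
    (hd.sub p.differentiable.differentiableOn)
    (fun z hz => (hp z (ball_subset_closedBall hz)).1.le) (fun z hz => by
      rw [deriv_fun_sub (hd.differentiableAt (isOpen_disc.mem_nhds hz)) p.differentiableAt]
      exact (hp z (ball_subset_closedBall hz)).2.le)
  refine ⟨p, fun z hz => ((hp z hz).1).trans_le (min_le_left _ _), this.1,
    this.2.trans_lt ?_⟩
  have h2 : δ ^ 2 ≤ ε / (2 * (1 + μ.real univ)) := by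
    rw [← Real.sq_sqrt (show 0 ≤ ε / (2 * (1 + μ.real univ)) by positivity)]
    gcongr
    exact min_le_right _ _
  calc δ ^ 2 * (1 + μ.real univ) ≤ ε / (2 * (1 + μ.real univ)) * (1 + μ.real univ) := by gcongr
    _ = ε / 2 := by field_simp
    _ < ε := by linarith

lemma exists_polynomial_dNormSq_lt [IsFiniteMeasure μ] (hμ : OnCircle μ) {g : ℂ → ℂ}
    (hg : MemD μ g) {ε : ℝ} (hε : 0 < ε) :
    ∃ p : Polynomial ℂ, dNormSq μ (fun z => g z - p.eval z) < ε := by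
  obtain ⟨n, hn⟩ := (eventually_dNormSq_sub_dilation_lt hμ hg (show 0 < ε / 4 by positivity)).exists
  obtain ⟨p, -, hp, hpn⟩ := exists_polynomial_dilation_approx hμ hg.1.1 n
    (show 0 < ε / 4 by positivity)
  have hgn := (hg.sub_add (hg.dilation hμ (sig_pos n) (sig_lt_one n)).1).1.1
  have := (hgn.sub_add hp).2.2
  simp only [sub_add_sub_cancel] at this
  exact ⟨p, by linarith⟩

/-- `ζ` is a bounded point evaluation of `D(μ)`. -/
def IsBPE (μ : Measure ℂ) (ζ : ℂ) : Prop :=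
  ∃ C > (0:ℝ), ∀ q : Polynomial ℂ,
    ‖q.eval ζ‖ ≤ C * Real.sqrt (dNormSq μ (fun z => q.eval z))

lemma IsBPE.not_isCyclic [IsFiniteMeasure μ] (hμ : OnCircle μ) {ζ : ℂ} (h : IsBPE μ ζ) :
    ¬ IsCyclic μ (fun z => z - ζ) := by
  intro hc
  obtain ⟨C, hC, hq⟩ := h
  have h1 : MemD μ fun z => (1 : Polynomial ℂ).eval z := memD_polynomial hμ 1
  have h2 : (fun z => (1 : Polynomial ℂ).eval z) ∈ closedSpan μ (fun z => z - ζ) := by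
    rw [hc]; exact h1
  obtain ⟨q, hqε⟩ := h2.2 ((1 / C) ^ 2) (by positivity)
  have h3 := hq (1 - q * (Polynomial.X - Polynomial.C ζ))
  simp only [Polynomial.eval_sub, Polynomial.eval_one, Polynomial.eval_mul, Polynomial.eval_X,
    Polynomial.eval_C, sub_self, mul_zero, sub_zero, norm_one] at h3 hqε
  have h4 := Real.sqrt_lt_sqrt (dNormSq_nonneg _) hqε
  rw [Real.sqrt_sq (by positivity)] at h4
  have : C * Real.sqrt (dNormSq μ fun z => 1 - q.eval z * (z - ζ)) < C * (1 / C) := by gcongr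
  rw [mul_one_div_cancel hC.ne'] at this
  linarith

lemma exists_polynomial_eval_eq_one [IsFiniteMeasure μ] (hμ : OnCircle μ) {ζ : ℂ}
    (h : ¬ IsBPE μ ζ) {ε : ℝ} (hε : 0 < ε) :
    ∃ p : Polynomial ℂ, p.eval ζ = 1 ∧ dNormSq μ (fun z => p.eval z) < ε := by
  simp only [IsBPE, not_exists, not_and, not_forall, not_le] at h
  obtain ⟨q, hq⟩ := h (1 / Real.sqrt ε) (by positivity)
  have hq0 : 0 < ‖q.eval ζ‖ := lt_of_le_of_lt (by positivity) hq
  have hne : q.eval ζ ≠ 0 := norm_pos_iff.1 hq0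
  refine ⟨Polynomial.C (q.eval ζ)⁻¹ * q, by simp [hne], ?_⟩
  simp only [Polynomial.eval_mul, Polynomial.eval_C]
  refine ((memD_polynomial hμ q).const_mul _).2.trans_lt ?_
  rw [one_div, inv_mul_lt_iff₀ (Real.sqrt_pos.2 hε)] at hq
  have h2 := pow_lt_pow_left₀ hq (Real.sqrt_nonneg _) two_ne_zero
  rw [Real.sq_sqrt (dNormSq_nonneg _), mul_pow, Real.sq_sqrt hε.le] at h2
  rw [norm_inv, inv_pow, inv_mul_lt_iff₀ (by positivity)]
  linarith

lemma isCyclic_of_not_isBPE [IsFiniteMeasure μ] (hμ : OnCircle μ) {ζ : ℂ} (h : ¬ IsBPE μ ζ) :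
    IsCyclic μ (fun z => z - ζ) := by
  refine Subset.antisymm (fun g hg => hg.1) fun g hg => ⟨hg, fun ε hε => ?_⟩
  obtain ⟨a, ha⟩ := exists_polynomial_dNormSq_lt hμ hg (show 0 < ε / 4 by positivity)
  obtain ⟨p, hp1, hp⟩ := exists_polynomial_eval_eq_one hμ h
    (show 0 < ε / (4 * (‖a.eval ζ‖ ^ 2 + 1)) by positivity)
  obtain ⟨b, hb⟩ : Polynomial.X - Polynomial.C ζ ∣ a - Polynomial.C (a.eval ζ) * p := by
    rw [Polynomial.dvd_iff_isRoot]; simp [hp1]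
  refine ⟨b, ?_⟩
  have e : (fun z => g z - b.eval z * (z - ζ)) =
      fun z => (g z - a.eval z) + a.eval ζ * p.eval z := by
    ext z
    have := congrArg (Polynomial.eval z) hb
    simp only [Polynomial.eval_sub, Polynomial.eval_mul, Polynomial.eval_C,
      Polynomial.eval_X] at this
    linear_combination this
  have h1 := (memD_polynomial hμ p).const_mul (a.eval ζ)
  have h2 := (((hg.sub_add (memD_polynomial hμ a)).1.1).sub_add h1.1).2.2
  rw [e]
  have h3 : ‖a.eval ζ‖ ^ 2 * dNormSq μ (fun z => p.eval z) ≤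
      ‖a.eval ζ‖ ^ 2 * (ε / (4 * (‖a.eval ζ‖ ^ 2 + 1))) := by gcongr
  have h4 : ‖a.eval ζ‖ ^ 2 * (ε / (4 * (‖a.eval ζ‖ ^ 2 + 1))) ≤ ε / 4 := by
    rw [mul_div_assoc', div_le_div_iff₀ (by positivity) (by positivity)]
    nlinarith [sq_nonneg ‖a.eval ζ‖]
  linarith [h1.2]

lemma norm_dilation_le_of_eval_le [IsFiniteMeasure μ] (hμ : OnCircle μ) {ζ : ℂ} (hζ : ‖ζ‖ = 1)
    {C : ℝ} (hC : 0 ≤ C) (hq : ∀ q : Polynomial ℂ,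
      ‖q.eval ζ‖ ≤ C * Real.sqrt (dNormSq μ (fun z => q.eval z)))
    {F : ℂ → ℂ} (hF : MemD μ F) (n : ℕ) {δ : ℝ} (hδ : 0 < δ) :
    ‖F ((sig n ^ 2 : ℝ) * ζ)‖ ≤ δ + C * Real.sqrt (2 * dNormSq μ F + 2 * δ) := by
  obtain ⟨p, hp, hpD, hpn⟩ := exists_polynomial_dilation_approx hμ hF.1.1 n hδ
  have hFn := hF.dilation hμ (sig_pos n) (sig_lt_one n)
  have h1 := (hFn.1.sub_add hpD).1.2
  simp only [sub_sub_cancel] at h1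
  have h2 := (hp ζ (by simp [hζ])).le
  have h3 := norm_add_le (F ((sig n ^ 2 : ℝ) * ζ) - p.eval ζ) (p.eval ζ)
  rw [sub_add_cancel] at h3
  refine h3.trans (add_le_add h2 ((hq p).trans ?_))
  gcongr
  linarith [hFn.2]

lemma circleMap_one_eq_bpt (t : ℝ) : circleMap 0 1 t = bpt t := by
  rw [← mul_bpt]; simp

lemma norm_bpt (t : ℝ) : ‖bpt t‖ = 1 := by
  rw [← circleMap_one_eq_bpt]; simp

lemma continuous_bpt : Continuous bpt := by
  unfold bpt; fun_prop

/-- The function on `ℂ` whose value at `e^{it}`, `0 < t ≤ 2π`, is `u t`. -/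
def boundaryLift (u : ℝ → ℝ) (w : ℂ) : ℝ := u (toIocMod Real.two_pi_pos 0 w.arg)

lemma boundaryLift_bpt (u : ℝ → ℝ) {t : ℝ} (ht : t ∈ Ioc 0 (2 * Real.pi)) :
    boundaryLift u (bpt t) = u t := by
  unfold boundaryLift
  congr 1
  have h : bpt t = Complex.exp ((bpt t).arg * Complex.I) := by
    conv_lhs => rw [← Complex.norm_mul_exp_arg_mul_I (bpt t), norm_bpt]
    simp
  rw [bpt, Complex.exp_eq_exp_iff_exists_int] at h
  obtain ⟨n, hn⟩ := h
  rw [toIocMod_eq_iff, zero_add]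
  refine ⟨ht, -n, ?_⟩
  have h2 : (t : ℂ) = (bpt t).arg + n * (2 * Real.pi) := by
    apply mul_left_cancel₀ Complex.I_ne_zero
    rw [hn, bpt]; ring
  have h3 : t = (bpt t).arg + n * (2 * Real.pi) := by exact_mod_cast h2
  simp only [zsmul_eq_mul, Int.cast_neg]
  linarith

lemma uIoc_two_pi : uIoc 0 (2 * Real.pi) = Ioc 0 (2 * Real.pi) :=
  uIoc_of_le Real.two_pi_pos.le

lemma integrableOn_of_sq {u : ℝ → ℝ} (hu0 : ∀ t, 0 ≤ u t)
    (hu : IntegrableOn (fun t => u t ^ 2) (Ioc 0 (2 * Real.pi))) :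
    IntegrableOn u (Ioc 0 (2 * Real.pi)) := by
  have hm : AEStronglyMeasurable u (volume.restrict (Ioc 0 (2 * Real.pi))) := by
    have h := (Real.continuous_sqrt.comp_aestronglyMeasurable hu.aestronglyMeasurable)
    have : (fun t => Real.sqrt (u t ^ 2)) = u := by
      ext t; exact Real.sqrt_sq (hu0 t)
    rwa [this] at h
  exact ((memLp_two_iff_integrable_sq hm).2 hu).integrable one_le_two

lemma circleAverage_eq_bpt (F : ℂ → ℝ) :
    circleAverage F 0 1 = (1 / (2 * Real.pi)) * ∫ t in (0:ℝ)..(2 * Real.pi), F (bpt t) := by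
  simp [Real.circleAverage_def, circleMap_one_eq_bpt]

lemma poissonExt_eq (u : ℝ → ℝ) (z : ℂ) : poissonExt u z =
    (1 / (2 * Real.pi)) * ∫ t in (0:ℝ)..(2 * Real.pi), diskKernel (bpt t) z * u t := by
  simp only [poissonExt, diskKernel_eq (norm_bpt _)]

lemma circleIntegrable_boundaryLift {u : ℝ → ℝ} (hu : IntegrableOn u (Ioc 0 (2 * Real.pi))) :
    CircleIntegrable (boundaryLift u) 0 1 := by
  rw [CircleIntegrable, intervalIntegrable_iff, uIoc_two_pi]
  refine hu.congr_fun (fun t ht => ?_) measurableSet_Ioc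
  rw [circleMap_one_eq_bpt, boundaryLift_bpt u ht]

/-- The Herglotz integral of `u`, whose real part is the Poisson extension. -/
def herglotz (u : ℝ → ℝ) (z : ℂ) : ℂ :=
  circleAverage (fun w => herglotzRieszKernel 0 z w • (boundaryLift u w : ℂ)) 0 1

lemma differentiableOn_herglotz {u : ℝ → ℝ} (hu : IntegrableOn u (Ioc 0 (2 * Real.pi))) :
    DifferentiableOn ℂ (herglotz u) disc := by
  refine differentiableOn_circleAverage_herglotzRieszKernel_smul ?_
  have := circleIntegrable_boundaryLift hu
  simp only [CircleIntegrable, intervalIntegrable_iff] at this ⊢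
  exact Complex.ofRealCLM.integrable_comp this

lemma re_herglotz {u : ℝ → ℝ} (hu : IntegrableOn u (Ioc 0 (2 * Real.pi))) {z : ℂ}
    (hz : z ∈ disc) : (herglotz u z).re = poissonExt u z := by
  rw [herglotz, re_circleAverage_herglotzRieszKernel_smul (circleIntegrable_boundaryLift hu) hz,
    circleAverage_eq_bpt, poissonExt_eq]
  congr 1
  refine intervalIntegral.integral_congr_ae (ae_of_all _ fun t ht => ?_)
  rw [uIoc_two_pi] at ht
  simp [boundaryLift_bpt u ht, diskKernel_eq_re (norm_bpt t), herglotzRieszKernel_def]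

lemma im_herglotz_zero {u : ℝ → ℝ} : (herglotz u 0).im = 0 := by
  have : herglotz u 0 = circleAverage (fun w => (boundaryLift u w : ℂ)) 0 1 := by
    unfold herglotz
    apply Real.circleAverage_congr_sphere
    intro w hw
    have : w ≠ 0 := by rintro rfl; simp at hw
    simp [herglotzRieszKernel_def, this]
  rw [this]
  simp only [Real.circleAverage_def, intervalIntegral.integral_ofReal]
  simp

lemma norm_fderiv_re {F : ℂ → ℂ} {z : ℂ} (hF : DifferentiableAt ℂ F z) :
    ‖fderiv ℝ (fun w => (F w).re) z‖ = ‖deriv F z‖ := by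
  have h1 : HasFDerivAt (fun w => (F w).re)
      (Complex.reCLM.comp ((ContinuousLinearMap.toSpanSingleton ℂ (deriv F z)).restrictScalars ℝ))
      z := Complex.reCLM.hasFDerivAt.comp z (hF.hasDerivAt.hasFDerivAt.restrictScalars ℝ)
  rw [h1.fderiv]
  set a := deriv F z
  apply le_antisymm
  · refine ContinuousLinearMap.opNorm_le_bound _ (norm_nonneg _) fun v => ?_
    simp only [ContinuousLinearMap.comp_apply, ContinuousLinearMap.coe_restrictScalars',
      ContinuousLinearMap.toSpanSingleton_apply, Complex.reCLM_apply, smul_eq_mul]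
    rw [mul_comm, Real.norm_eq_abs]
    refine (Complex.abs_re_le_norm _).trans ?_
    rw [mul_comm, norm_mul, mul_comm]
  · rcases eq_or_ne a 0 with h0 | h0
    · rw [h0, norm_zero]; exact norm_nonneg _
    have := ContinuousLinearMap.le_opNorm (Complex.reCLM.comp
      ((ContinuousLinearMap.toSpanSingleton ℂ a).restrictScalars ℝ)) ((starRingEnd ℂ) a)
    simp only [ContinuousLinearMap.comp_apply, ContinuousLinearMap.coe_restrictScalars',
      ContinuousLinearMap.toSpanSingleton_apply, Complex.reCLM_apply, smul_eq_mul] at this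
    rw [Complex.conj_mul', ← Complex.ofReal_pow, Complex.ofReal_re, Complex.norm_conj,
      Real.norm_eq_abs, abs_of_nonneg (by positivity), sq] at this
    exact le_of_mul_le_mul_right this (norm_pos_iff.2 h0)

lemma norm_fderiv_poissonExt {u : ℝ → ℝ} (hu : IntegrableOn u (Ioc 0 (2 * Real.pi))) {z : ℂ}
    (hz : z ∈ disc) : ‖fderiv ℝ (poissonExt u) z‖ = ‖deriv (herglotz u) z‖ := by
  have hn := isOpen_disc.mem_nhds hz
  rw [← norm_fderiv_re ((differentiableOn_herglotz hu).differentiableAt hn)]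
  congr 1
  refine Filter.EventuallyEq.fderiv_eq ?_
  filter_upwards [hn] with w hw using (re_herglotz hu hw).symm

lemma measurable_normSq_fderiv (u : ℝ → ℝ) :
    Measurable fun z => ‖fderiv ℝ (poissonExt u) z‖ ^ 2 :=
  (measurable_fderiv ℝ _).norm.pow_const 2

lemma lintegral_gradDensity {u : ℝ → ℝ} (hu : IntegrableOn u (Ioc 0 (2 * Real.pi))) :
    ∫⁻ z in disc, ENNReal.ofReal (gradDensity μ u z) = energy μ (herglotz u) :=
  setLIntegral_congr_fun measurableSet_disc fun z hz => by
    simp only [gradDensity, dirichletDensity, norm_fderiv_poissonExt hu hz]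

lemma memDh_iff [IsFiniteMeasure μ] {u : ℝ → ℝ} (hu : IntegrableOn u (Ioc 0 (2 * Real.pi))) :
    MemDh μ u ↔ IntegrableOn (fun t => u t ^ 2) (Ioc 0 (2 * Real.pi)) ∧
      energy μ (herglotz u) ≠ ⊤ := by
  rw [MemDh, ← lintegral_gradDensity hu]
  exact and_congr_right fun _ => integrableOn_weight_iff (measurable_normSq_fderiv u)
    fun _ => by positivity

lemma dhNormSq_eq [IsFiniteMeasure μ] {u : ℝ → ℝ} (hu : IntegrableOn u (Ioc 0 (2 * Real.pi))) :
    dhNormSq μ u = (1 / (2 * Real.pi)) * (∫ t in Ioc 0 (2 * Real.pi), u t ^ 2) +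
      (1 / Real.pi) * (energy μ (herglotz u)).toReal := by
  rw [dhNormSq, ← lintegral_gradDensity hu]
  congr 2
  exact integral_weight_eq (measurable_normSq_fderiv u) fun _ => by positivity

lemma exists_diskKernel_le {z : ℂ} (hz : z ∈ disc) :
    ∃ C, ∀ t, ‖diskKernel (bpt t) z‖ ≤ C := by
  obtain ⟨C, hC⟩ := (isCompact_sphere (0 : ℂ) 1).exists_bound_of_continuousOn
    (continuousOn_diskKernel_left (norm_lt_one_of_mem_disc hz))
  exact ⟨C, fun t => hC _ (by simp [norm_bpt])⟩

lemma continuous_diskKernel_bpt {z : ℂ} (hz : z ∈ disc) :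
    Continuous fun t => diskKernel (bpt t) z :=
  (continuousOn_diskKernel_left (norm_lt_one_of_mem_disc hz)).comp_continuous continuous_bpt
    fun t => by simp [norm_bpt]

lemma integrableOn_diskKernel_mul {f : ℝ → ℝ} (hf : IntegrableOn f (Ioc 0 (2 * Real.pi)))
    {z : ℂ} (hz : z ∈ disc) :
    IntegrableOn (fun t => diskKernel (bpt t) z * f t) (Ioc 0 (2 * Real.pi)) := by
  obtain ⟨C, hC⟩ := exists_diskKernel_le hz
  exact hf.bdd_mul (continuous_diskKernel_bpt hz).aestronglyMeasurable (ae_of_all _ hC)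

lemma integral_diskKernel_bpt {z : ℂ} (hz : z ∈ disc) :
    ∫ t in Ioc 0 (2 * Real.pi), diskKernel (bpt t) z = 2 * Real.pi := by
  have := circleAverage_diskKernel_mul_re (f := fun _ => 1) diffContOnCl_const
    (norm_lt_one_of_mem_disc hz)
  rw [circleAverage_eq_bpt, intervalIntegral.integral_of_le Real.two_pi_pos.le] at this
  simp only [Complex.one_re, mul_one] at this
  field_simp at this
  linarith

lemma poissonExt_eq' (u : ℝ → ℝ) (z : ℂ) : poissonExt u z =
    (1 / (2 * Real.pi)) * ∫ t in Ioc 0 (2 * Real.pi), diskKernel (bpt t) z * u t := by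
  rw [poissonExt_eq, intervalIntegral.integral_of_le Real.two_pi_pos.le]

lemma poissonExt_sq_le {u : ℝ → ℝ} (hu : IntegrableOn u (Ioc 0 (2 * Real.pi)))
    (hu2 : IntegrableOn (fun t => u t ^ 2) (Ioc 0 (2 * Real.pi))) {z : ℂ} (hz : z ∈ disc) :
    poissonExt u z ^ 2 ≤ poissonExt (fun t => u t ^ 2) z := by
  set a := poissonExt u z with ha
  have h1 := integrableOn_diskKernel_mul hu hz
  have h2 := integrableOn_diskKernel_mul hu2 hz
  have h0 : IntegrableOn (fun t => diskKernel (bpt t) z) (Ioc 0 (2 * Real.pi)) :=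
    ((continuous_diskKernel_bpt hz).continuousOn.integrableOn_compact isCompact_Icc).mono_set
      Ioc_subset_Icc_self
  have hpos : 0 ≤ ∫ t in Ioc 0 (2 * Real.pi), diskKernel (bpt t) z * (u t - a) ^ 2 :=
    integral_nonneg fun t => mul_nonneg (diskKernel_nonneg _ (norm_le_one_of_mem_disc hz))
      (sq_nonneg _)
  have e : ∀ t, diskKernel (bpt t) z * (u t - a) ^ 2 = diskKernel (bpt t) z * u t ^ 2 -
      2 * a * (diskKernel (bpt t) z * u t) + a ^ 2 * diskKernel (bpt t) z := fun t => by ring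
  simp only [e] at hpos
  have h3 : Integrable (fun t => 2 * a * (diskKernel (bpt t) z * u t))
      (volume.restrict (Ioc 0 (2 * Real.pi))) := h1.const_mul (2 * a)
  have h4 : Integrable (fun t => diskKernel (bpt t) z * u t ^ 2 -
      2 * a * (diskKernel (bpt t) z * u t)) (volume.restrict (Ioc 0 (2 * Real.pi))) := h2.sub h3
  rw [integral_add h4 (h0.const_mul _), integral_sub h2 h3,
    integral_const_mul, integral_const_mul, integral_diskKernel_bpt hz] at hpos
  have ha' : ∫ t in Ioc 0 (2 * Real.pi), diskKernel (bpt t) z * u t = 2 * Real.pi * a := by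
    rw [ha, poissonExt_eq']; field_simp
  rw [ha'] at hpos
  rw [poissonExt_eq', one_div, inv_mul_eq_div, le_div_iff₀ Real.two_pi_pos]
  linarith

lemma circleAverage_poissonExt {f : ℝ → ℝ} (hf : IntegrableOn f (Ioc 0 (2 * Real.pi))) {r : ℝ}
    (h0 : 0 ≤ r) (h1 : r < 1) :
    CircleIntegrable (poissonExt f) 0 r ∧ circleAverage (poissonExt f) 0 r =
      (1 / (2 * Real.pi)) * ∫ t in Ioc 0 (2 * Real.pi), f t := by
  have hcont : Continuous fun p : ℝ × ℝ => diskKernel (bpt p.2) (circleMap 0 r p.1) := by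
    refine continuousOn_diskKernel.comp_continuous
      (f := fun p : ℝ × ℝ => (bpt p.2, circleMap 0 r p.1)) ?_ fun p =>
        ⟨by simp [norm_bpt], circleMap_mem_disc h0 h1 p.1⟩
    exact (continuous_bpt.comp continuous_snd).prodMk ((continuous_circleMap 0 r).comp continuous_fst)
  have hbd : ∃ C, ∀ p : ℝ × ℝ, ‖diskKernel (bpt p.2) (circleMap 0 r p.1)‖ ≤ C := by
    obtain ⟨C, hC⟩ := ((isCompact_sphere (0 : ℂ) 1).prod
      (isCompact_closedBall (0 : ℂ) r)).exists_bound_of_continuousOn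
      (continuousOn_diskKernel.mono (prod_mono_right (closedBall_subset_ball h1)))
    exact ⟨C, fun p => hC (bpt p.2, circleMap 0 r p.1)
      ⟨by simp [norm_bpt], by simp [abs_of_nonneg h0]⟩⟩
  obtain ⟨C, hC⟩ := hbd
  have hprod : Integrable (Function.uncurry fun θ t => diskKernel (bpt t) (circleMap 0 r θ) * f t)
      ((volume.restrict (Ioc 0 (2 * Real.pi))).prod (volume.restrict (Ioc 0 (2 * Real.pi)))) :=
    (Integrable.comp_snd hf _).bdd_mul hcont.aestronglyMeasurable (ae_of_all _ hC)
  have hswap := integral_integral_swap hprod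
  refine ⟨?_, ?_⟩
  · rw [CircleIntegrable, intervalIntegrable_iff, uIoc_two_pi]
    simp only [poissonExt_eq']
    exact (hprod.integral_prod_left).const_mul _
  · rw [Real.circleAverage_def, intervalIntegral.integral_of_le Real.two_pi_pos.le, smul_eq_mul,
      ← one_div]
    simp only [poissonExt_eq', integral_const_mul]
    rw [hswap]
    congr 1
    rw [← integral_const_mul]
    refine integral_congr_ae (ae_of_all _ fun t => ?_)
    simp only [integral_mul_const]
    have := circleAverage_diskKernel (norm_bpt t) h0 h1
    rw [Real.circleAverage_def, intervalIntegral.integral_of_le Real.two_pi_pos.le, smul_eq_mul,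
      ← one_div] at this
    rw [← mul_assoc, this, one_mul]

lemma circleAverage_re {f : ℂ → ℂ} (hf : DifferentiableOn ℂ f disc) {r : ℝ} (h0 : 0 ≤ r)
    (h1 : r < 1) : circleAverage (fun z => (f z).re) 0 r = (f 0).re := by
  rw [circleAverage_ofReal_radius]
  have := circleAverage_diskKernel_mul_re (diffContOnCl_comp_mul hf h0 h1) (w := 0) (by simp)
  simpa [diskKernel] using this

lemma meanSq_herglotz_le {u : ℝ → ℝ} (hu : IntegrableOn u (Ioc 0 (2 * Real.pi)))
    (hu2 : IntegrableOn (fun t => u t ^ 2) (Ioc 0 (2 * Real.pi))) {r : ℝ} (h0 : 0 ≤ r)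
    (h1 : r < 1) : meanSq (herglotz u) r ≤
      2 * ((1 / (2 * Real.pi)) * ∫ t in Ioc 0 (2 * Real.pi), u t ^ 2) := by
  have hF := differentiableOn_herglotz hu
  have hc := hF.continuousOn
  have e : (fun z => ‖herglotz u z‖ ^ 2) = fun z =>
      2 * (herglotz u z).re ^ 2 - (herglotz u z ^ 2).re := by
    ext z
    rw [Complex.sq_norm, Complex.normSq_apply, sq (herglotz u z), Complex.mul_re]
    ring
  have i1 : CircleIntegrable (fun z => 2 * (herglotz u z).re ^ 2) 0 r :=
    circleIntegrable_of_continuousOn_disc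
      (continuousOn_const.mul ((Complex.continuous_re.comp_continuousOn hc).pow 2)) h0 h1
  have i2 : CircleIntegrable (fun z => (herglotz u z ^ 2).re) 0 r :=
    circleIntegrable_of_continuousOn_disc (Complex.continuous_re.comp_continuousOn (hc.pow 2)) h0 h1
  obtain ⟨i3, e3⟩ := circleAverage_poissonExt hu2 h0 h1
  have hle : circleAverage (fun z => 2 * (herglotz u z).re ^ 2) 0 r ≤
      circleAverage (fun z => 2 * poissonExt (fun t => u t ^ 2) z) 0 r := by
    refine Real.circleAverage_mono i1 (i3.const_mul 2) fun z hz => ?_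
    have hz' : z ∈ disc := sphere_subset_disc h0 h1 hz
    rw [re_herglotz hu hz']
    exact mul_le_mul_of_nonneg_left (poissonExt_sq_le hu hu2 hz') zero_le_two
  have e4 : circleAverage (fun z => 2 * poissonExt (fun t => u t ^ 2) z) 0 r =
      2 * circleAverage (poissonExt (fun t => u t ^ 2)) 0 r :=
    Real.circleAverage_fun_smul (a := (2 : ℝ)) (f := poissonExt (fun t => u t ^ 2))
  rw [e4, e3] at hle
  rw [meanSq, e, Real.circleAverage_fun_sub i1 i2,
    circleAverage_re (f := fun z => herglotz u z ^ 2) (hF.pow 2) h0 h1, sq (herglotz u 0),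
    Complex.mul_re, im_herglotz_zero]
  nlinarith [mul_self_nonneg (herglotz u 0).re]

lemma MemDh.integrableOn {u : ℝ → ℝ} (h : MemDh μ u) (hu0 : ∀ t, 0 ≤ u t) :
    IntegrableOn u (Ioc 0 (2 * Real.pi)) := integrableOn_of_sq hu0 h.1

lemma MemDh.memD_herglotz [IsFiniteMeasure μ] {u : ℝ → ℝ} (h : MemDh μ u) (hu0 : ∀ t, 0 ≤ u t) :
    MemD μ (herglotz u) ∧ dNormSq μ (herglotz u) ≤ 2 * dhNormSq μ u := by
  have hu := h.integrableOn hu0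
  have hm := fun r (h0 : 0 < r) (h1 : r < 1) => meanSq_herglotz_le hu h.1 h0.le h1
  refine ⟨memD_iff.2 ⟨differentiableOn_herglotz hu, bddAbove_hardySet hm,
    ((memDh_iff hu).1 h).2⟩, ?_⟩
  rw [dNormSq_eq, dhNormSq_eq hu]
  have h1 := hardyNormSq_le hm
  have h2 : 0 ≤ (1 / Real.pi) * (energy μ (herglotz u)).toReal := by positivity
  linarith

lemma eventually_half_le_poissonExt {u : ℝ → ℝ} (hu : IntegrableOn u (Ioc 0 (2 * Real.pi)))
    (hu0 : ∀ t, 0 ≤ u t) {ζ : ℂ} (hζ : ‖ζ‖ = 1) {η : ℝ} (hη : 0 < η)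
    (h : ∀ᵐ t ∂θm, dist (bpt t) ζ < η → 1 ≤ u t) :
    ∀ᶠ n in atTop, 1 / 2 ≤ poissonExt u ((sig n ^ 2 : ℝ) * ζ) := by
  have ev1 : ∀ᶠ n in atTop, 1 - sig n ^ 2 < η / 2 := by
    have := (tendsto_const_nhds (x := (1 : ℝ))).sub tendsto_sig_sq
    rw [sub_self] at this
    exact this.eventually_lt_const (by positivity)
  have ev2 : ∀ᶠ n in atTop, (1 - (sig n ^ 2) ^ 2) < η ^ 2 / 8 := by
    have := (tendsto_const_nhds (x := (1 : ℝ))).sub (tendsto_sig_sq.pow 2)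
    rw [one_pow, sub_self] at this
    exact this.eventually_lt_const (by positivity)
  filter_upwards [ev1, ev2] with n h1 h2
  set r := sig n ^ 2 with hr
  have hr0 : 0 ≤ r := sig_sq_nonneg n
  have hr1 : r < 1 := by
    have := sig_pos n
    have := sig_lt_one n
    nlinarith
  have hrz : (r : ℂ) * ζ ∈ disc := by
    simp [disc, hζ, abs_of_nonneg hr0, hr1]
  have hnr : ‖(r : ℂ) * ζ‖ = r := by simp [hζ, abs_of_nonneg hr0]
  have hk0 : IntegrableOn (fun t => diskKernel (bpt t) (r * ζ)) (Ioc 0 (2 * Real.pi)) :=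
    ((continuous_diskKernel_bpt hrz).continuousOn.integrableOn_compact isCompact_Icc).mono_set
      Ioc_subset_Icc_self
  have hle : ∫ t in Ioc 0 (2 * Real.pi), (diskKernel (bpt t) (r * ζ) - 1 / 2) ≤
      ∫ t in Ioc 0 (2 * Real.pi), diskKernel (bpt t) (r * ζ) * u t := by
    refine integral_mono_ae (hk0.sub (integrable_const _)) (integrableOn_diskKernel_mul hu hrz) ?_
    filter_upwards [h] with t ht
    have hk := diskKernel_nonneg (bpt t) (norm_le_one_of_mem_disc hrz)
    by_cases hd : dist (bpt t) ζ < η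
    · nlinarith [ht hd]
    · push Not at hd
      have hdist : η / 2 ≤ ‖bpt t - r * ζ‖ := by
        have e : ‖(r : ℂ) * ζ - ζ‖ = 1 - r := by
          rw [show (r : ℂ) * ζ - ζ = ((r - 1 : ℝ) : ℂ) * ζ by push_cast; ring, norm_mul, hζ,
            mul_one, Complex.norm_real, Real.norm_eq_abs, abs_of_nonpos (by linarith)]
          ring
        have := norm_add_le (bpt t - r * ζ) (r * ζ - ζ)
        rw [sub_add_sub_cancel, ← dist_eq_norm, e] at this
        linarith
      have : diskKernel (bpt t) (r * ζ) ≤ 1 / 2 := by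
        have hpos : 0 < ‖bpt t - r * ζ‖ := lt_of_lt_of_le (by positivity) hdist
        rw [diskKernel_eq (norm_bpt t), hnr, div_le_iff₀ (by positivity)]
        nlinarith
      nlinarith [mul_nonneg hk (hu0 t)]
  rw [integral_sub hk0 (integrable_const _), integral_diskKernel_bpt hrz] at hle
  rw [poissonExt_eq', one_div (2 * Real.pi), inv_mul_eq_div, le_div_iff₀ Real.two_pi_pos]
  simp [Real.pi_pos.le] at hle
  linarith

lemma IsBPE.cap_pos [IsFiniteMeasure μ] (hμ : OnCircle μ) {ζ : ℂ} (hζ : ‖ζ‖ = 1)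
    (h : IsBPE μ ζ) : 0 < cap μ {ζ} := by
  obtain ⟨C, hC, hq⟩ := h
  refine lt_of_lt_of_le (b := ENNReal.ofReal (1 / (128 * C ^ 2)))
    (ENNReal.ofReal_pos.2 (by positivity)) ?_
  refine le_iInf₂ fun U hU => le_iInf₂ fun u ⟨hu, hu0, hu1⟩ => ENNReal.ofReal_le_ofReal ?_
  obtain ⟨⟨V, hV, rfl⟩, hζV⟩ := hU
  obtain ⟨η, hη, hηV⟩ := Metric.isOpen_iff.1 hV ζ (hζV rfl).1
  obtain ⟨hF, hFn⟩ := hu.memD_herglotz hu0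
  have hui := hu.integrableOn hu0
  obtain ⟨n, hn⟩ := (eventually_half_le_poissonExt hui hu0 hζ hη (by
    filter_upwards [hu1] with t ht hd
    exact ht ⟨hηV hd, by simp [circleT, norm_bpt]⟩)).exists
  set δ := min (1 / 4) (1 / (64 * C ^ 2)) with hδ
  have hδ0 : 0 < δ := by positivity
  have h1 := norm_dilation_le_of_eval_le hμ hζ hC.le hq hF n hδ0
  have hz : ((sig n ^ 2 : ℝ) : ℂ) * ζ ∈ disc := by
    have := sig_pos n
    have := sig_lt_one n
    have : sig n ^ 2 < 1 := by nlinarith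
    simpa [disc, hζ, abs_of_nonneg (sig_pos n).le] using this
  rw [← re_herglotz hui hz] at hn
  have h2 := hn.trans ((Complex.re_le_norm _).trans h1)
  have h3 : 1 / 4 ≤ C * Real.sqrt (2 * dNormSq μ (herglotz u) + 2 * δ) := by
    have : δ ≤ 1 / 4 := min_le_left _ _
    linarith
  have h4 := pow_le_pow_left₀ (by norm_num) h3 2
  have h5 : δ * (64 * C ^ 2) ≤ 1 := by
    rw [← le_div_iff₀ (by positivity)]; exact min_le_right _ _
  rw [mul_pow, Real.sq_sqrt (by have := dNormSq_nonneg (μ := μ) (herglotz u); positivity)] at h4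
  rw [div_le_iff₀ (by positivity)]
  nlinarith [sq_nonneg C]

lemma hasSum_circleAverage_mul {b : ℕ → ℂ} (hb : Summable fun n => ‖b n‖) {e : ℕ → ℂ → ℂ}
    (he : ∀ n, ContinuousOn (e n) (sphere 0 1)) (he1 : ∀ n, ∀ w ∈ sphere (0 : ℂ) 1, ‖e n w‖ ≤ 1)
    {B : ℂ → ℂ} (hB : ∀ w ∈ sphere (0 : ℂ) 1, HasSum (fun n => b n * e n w) (B w))
    {φ : ℂ → ℂ} (hφ : CircleIntegrable φ 0 1) :
    HasSum (fun n => b n * circleAverage (fun w => φ w * e n w) 0 1)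
      (circleAverage (fun w => φ w * B w) 0 1) := by
  have hmem : ∀ t, circleMap 0 1 t ∈ sphere (0 : ℂ) 1 := fun t => by simp
  have hec : ∀ n, Continuous fun t => e n (circleMap 0 1 t) := fun n =>
    (he n).comp_continuous (continuous_circleMap 0 1) hmem
  rw [CircleIntegrable, intervalIntegrable_iff] at hφ
  have key : HasSum (fun n => ∫ t in (0 : ℝ)..(2 * Real.pi),
      b n * (φ (circleMap 0 1 t) * e n (circleMap 0 1 t)))
      (∫ t in (0 : ℝ)..(2 * Real.pi), φ (circleMap 0 1 t) * B (circleMap 0 1 t)) := by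
    refine intervalIntegral.hasSum_integral_of_dominated_convergence
      (fun n t => ‖b n‖ * ‖φ (circleMap 0 1 t)‖) ?_ ?_ ?_ ?_ ?_
    · exact fun n => (hφ.aestronglyMeasurable.mul (hec n).aestronglyMeasurable).const_mul _
    · refine fun n => ae_of_all _ fun t _ => ?_
      rw [norm_mul, norm_mul]
      have := he1 n _ (hmem t)
      gcongr
      nlinarith [norm_nonneg (φ (circleMap 0 1 t))]
    · exact ae_of_all _ fun t _ => hb.mul_right _
    · simp only [tsum_mul_right]
      rw [intervalIntegrable_iff]
      exact hφ.norm.const_mul _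
    · refine ae_of_all _ fun t _ => ?_
      simp only [mul_left_comm (b _)]
      exact (hB _ (hmem t)).mul_left (φ (circleMap 0 1 t))
  simp only [intervalIntegral.integral_const_mul] at key
  have := key.const_smul ((2 * Real.pi)⁻¹ : ℝ)
  simp only [Real.circleAverage_def]
  convert this using 1
  ext n
  simp only [Complex.real_smul]
  ring

lemma circleAverage_conj (f : ℂ → ℂ) (c : ℂ) (R : ℝ) :
    circleAverage (fun z => (starRingEnd ℂ) (f z)) c R =
      (starRingEnd ℂ) (circleAverage f c R) := by
  simp only [Real.circleAverage_def, intervalIntegral.integral_of_le Real.two_pi_pos.le,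
    integral_conj, Complex.real_smul, map_mul, Complex.conj_ofReal]

lemma conj_mul_self_of_mem_sphere {w : ℂ} (hw : w ∈ sphere (0 : ℂ) 1) :
    (starRingEnd ℂ) w * w = 1 := by
  rw [Complex.conj_mul', mem_sphere_zero_iff_norm.1 hw]; norm_num

lemma circleAverage_pow (k : ℕ) :
    circleAverage (fun w : ℂ => w ^ k) 0 1 = if k = 0 then 1 else 0 := by
  have := circleAverage_diskKernel_smul (f := fun w => w ^ k) (w := 0)
    (by apply Differentiable.diffContOnCl; fun_prop) (by simp)
  simpa [diskKernel, zero_pow_eq] using this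

lemma circleAverage_conj_pow_mul_pow (m n : ℕ) :
    circleAverage (fun w : ℂ => (starRingEnd ℂ) (w ^ m) * w ^ n) 0 1 = if n = m then 1 else 0 := by
  have key : ∀ m k : ℕ, circleAverage (fun w : ℂ => (starRingEnd ℂ) (w ^ m) * w ^ (m + k)) 0 1 =
      if k = 0 then 1 else 0 := by
    intro m k
    rw [← circleAverage_pow k]
    apply Real.circleAverage_congr_sphere
    intro w hw
    rw [abs_one] at hw
    dsimp only
    rw [pow_add, ← mul_assoc, map_pow, ← mul_pow, conj_mul_self_of_mem_sphere hw, one_pow, one_mul]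
  rcases le_total m n with h | h
  · obtain ⟨k, rfl⟩ := Nat.exists_eq_add_of_le h
    rw [key]
    simp
  · obtain ⟨k, rfl⟩ := Nat.exists_eq_add_of_le h
    have : (fun w : ℂ => (starRingEnd ℂ) (w ^ (n + k)) * w ^ n) =
        fun w : ℂ => (starRingEnd ℂ) ((starRingEnd ℂ) (w ^ n) * w ^ (n + k)) := by
      ext w; simp [mul_comm]
    rw [this, circleAverage_conj, key]
    split_ifs with h1 h2 h2 <;> simp at h1 h2 ⊢ <;> omega

lemma hasSum_sq_coeff {b : ℕ → ℂ} (hb : Summable fun n => ‖b n‖) {B : ℂ → ℂ}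
    (hB : ∀ w ∈ sphere (0 : ℂ) 1, HasSum (fun n => b n * w ^ n) (B w))
    (hc : ContinuousOn B (sphere 0 1)) :
    (∀ m, circleAverage (fun w => (starRingEnd ℂ) (w ^ m) * B w) 0 1 = b m) ∧
    HasSum (fun n => ‖b n‖ ^ 2) (circleAverage (fun w => ‖B w‖ ^ 2) 0 1) := by
  have hcoef : ∀ m, circleAverage (fun w => (starRingEnd ℂ) (w ^ m) * B w) 0 1 = b m := by
    intro m
    have := hasSum_circleAverage_mul hb (e := fun n w => w ^ n)
      (fun n => by fun_prop) (fun n w hw => by simp [mem_sphere_zero_iff_norm.1 hw]) hB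
      (φ := fun w => (starRingEnd ℂ) (w ^ m)) (circleIntegrable_of_continuousOn_unit
        (Complex.continuous_conj.comp (continuous_pow m)).continuousOn)
    simp only [circleAverage_conj_pow_mul_pow, mul_ite, mul_one, mul_zero] at this
    refine this.unique ?_
    simpa using hasSum_single (f := fun n => if n = m then b n else 0) m
      fun n hn => if_neg hn
  refine ⟨hcoef, ?_⟩
  have := hasSum_circleAverage_mul hb (e := fun n w => w ^ n)
    (fun n => by fun_prop) (fun n w hw => by simp [mem_sphere_zero_iff_norm.1 hw]) hB
    (φ := fun w => (starRingEnd ℂ) (B w)) (circleIntegrable_of_continuousOn_unit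
      (Complex.continuous_conj.comp_continuousOn hc))
  have e1 : ∀ n, b n * circleAverage (fun w => (starRingEnd ℂ) (B w) * w ^ n) 0 1 =
      ((‖b n‖ ^ 2 : ℝ) : ℂ) := by
    intro n
    have : (fun w => (starRingEnd ℂ) (B w) * w ^ n) =
        fun w => (starRingEnd ℂ) ((starRingEnd ℂ) (w ^ n) * B w) := by
      ext w; simp [mul_comm]
    rw [this, circleAverage_conj, hcoef, Complex.mul_conj']
    norm_cast
  have e2 : circleAverage (fun w => (starRingEnd ℂ) (B w) * B w) 0 1 =
      ((circleAverage (fun w => ‖B w‖ ^ 2) 0 1 : ℝ) : ℂ) := by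
    simp only [Complex.conj_mul', Real.circleAverage_def, ← Complex.ofReal_pow,
      intervalIntegral.integral_ofReal, Complex.real_smul, smul_eq_mul, Complex.ofReal_mul]
  simp only [e1, e2] at this
  exact Complex.hasSum_ofReal.1 this

/-- `f` is the sum on the disc of the power series with coefficients `a`. -/
def HasCoeffs (a : ℕ → ℂ) (f : ℂ → ℂ) : Prop :=
  ∀ z ∈ disc, HasSum (fun n => a n * z ^ n) (f z)

lemma ofReal_mul_mem_disc {ρ : ℝ} (h0 : 0 ≤ ρ) (h1 : ρ < 1) {w : ℂ} (hw : w ∈ sphere (0 : ℂ) 1) :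
    (ρ : ℂ) * w ∈ disc := by
  simp [disc, mem_sphere_zero_iff_norm.1 hw, abs_of_nonneg h0, h1]

lemma HasCoeffs.summable_norm {a : ℕ → ℂ} {f : ℂ → ℂ} (h : HasCoeffs a f) {z : ℂ}
    (hz : z ∈ disc) : Summable fun n => ‖a n * z ^ n‖ :=
  (h z hz).summable.norm

lemma HasCoeffs.sq_coeff {a : ℕ → ℂ} {f : ℂ → ℂ} (h : HasCoeffs a f) (hc : ContinuousOn f disc)
    {ρ : ℝ} (h0 : 0 ≤ ρ) (h1 : ρ < 1) :
    (∀ m, circleAverage (fun w => (starRingEnd ℂ) (w ^ m) * f (ρ * w)) 0 1 = a m * ρ ^ m) ∧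
    HasSum (fun n => ‖a n‖ ^ 2 * ρ ^ (2 * n)) (meanSq f ρ) := by
  have hmem := fun w hw => ofReal_mul_mem_disc h0 h1 (w := w) hw
  have key := hasSum_sq_coeff (b := fun n => a n * ρ ^ n) (B := fun w => f (ρ * w))
    (h.summable_norm (by simpa using hmem 1 (by simp)))
    (fun w hw => by simpa only [mul_pow, mul_assoc] using h _ (hmem w hw))
    (hc.comp (by fun_prop) hmem)
  refine ⟨key.1, ?_⟩
  rw [meanSq, circleAverage_ofReal_radius]
  convert key.2 using 2 with n
  rw [norm_mul, mul_pow, norm_pow, Complex.norm_real, Real.norm_eq_abs, abs_of_nonneg h0]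
  ring

lemma HasCoeffs.unique {a b : ℕ → ℂ} {f : ℂ → ℂ} (ha : HasCoeffs a f) (hb : HasCoeffs b f)
    (hc : ContinuousOn f disc) : a = b := by
  ext m
  have h1 := (ha.sq_coeff hc (ρ := 1 / 2) (by norm_num) (by norm_num)).1 m
  have h2 := (hb.sq_coeff hc (ρ := 1 / 2) (by norm_num) (by norm_num)).1 m
  rw [h1] at h2
  exact mul_right_cancel₀ (pow_ne_zero _ (by norm_num)) h2

lemma hasCoeffs_taylor {f : ℂ → ℂ} (hf : DifferentiableOn ℂ f disc) :
    HasCoeffs (fun n => (n.factorial : ℂ)⁻¹ * iteratedDeriv n f 0) f := by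
  intro z hz
  have := Complex.hasSum_taylorSeries_on_ball hf hz
  simp only [sub_zero, smul_eq_mul] at this
  simpa only [mul_comm, mul_left_comm, mul_assoc] using this

lemma HasCoeffs.deriv {a : ℕ → ℂ} {f : ℂ → ℂ} (h : HasCoeffs a f)
    (hf : DifferentiableOn ℂ f disc) : HasCoeffs (fun n => (n + 1) * a (n + 1)) (deriv f) := by
  have := hasCoeffs_taylor (hf.deriv isOpen_disc)
  convert this using 2 with n
  rw [h.unique (hasCoeffs_taylor hf) hf.continuousOn, ← iteratedDeriv_succ']
  dsimp only
  rw [Nat.factorial_succ]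
  push_cast
  have : (n : ℂ) + 1 ≠ 0 := by exact_mod_cast n.succ_ne_zero
  field_simp

lemma integral_radial_weight (n : ℕ) (c : ℝ) :
    ∫ ρ in (0 : ℝ)..1, 2 * Real.pi * ρ * (c * ρ ^ (2 * n) * (1 - ρ ^ 2)) =
      Real.pi * c / ((n + 1) * (n + 2)) := by
  have e : ∀ ρ : ℝ, 2 * Real.pi * ρ * (c * ρ ^ (2 * n) * (1 - ρ ^ 2)) =
      2 * Real.pi * c * (ρ ^ (2 * n + 1) - ρ ^ (2 * n + 3)) := fun ρ => by ring
  simp only [e]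
  rw [intervalIntegral.integral_const_mul, intervalIntegral.integral_sub
    (by apply Continuous.intervalIntegrable; fun_prop)
    (by apply Continuous.intervalIntegrable; fun_prop), integral_pow, integral_pow]
  have h1 : (n : ℝ) + 1 ≠ 0 := by positivity
  have h2 : (n : ℝ) + 2 ≠ 0 := by positivity
  have h3 : (2 * n + 1 + 1 : ℝ) ≠ 0 := by positivity
  have h4 : (2 * n + 3 + 1 : ℝ) ≠ 0 := by positivity
  push_cast
  simp only [one_pow, ne_eq, Nat.add_eq_zero_iff, not_false_eq_true, zero_pow, sub_zero,
    one_ne_zero, and_false, OfNat.ofNat_ne_zero]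
  field_simp
  ring

lemma HasCoeffs.lintegral_sq {a : ℕ → ℂ} {f : ℂ → ℂ} (h : HasCoeffs a f)
    (hc : ContinuousOn f disc) :
    ∫⁻ z in disc, ENNReal.ofReal (‖f z‖ ^ 2 * (1 - ‖z‖ ^ 2)) =
      ∑' n : ℕ, ENNReal.ofReal (Real.pi * ‖a n‖ ^ 2 / ((n + 1) * (n + 2))) := by
  have hpos : ∀ {z}, z ∈ disc → 0 ≤ 1 - ‖z‖ ^ 2 := fun {z} hz => by
    nlinarith [norm_le_one_of_mem_disc hz, norm_nonneg z]
  rw [lintegral_disc_eq (F := fun z => ‖f z‖ ^ 2 * (1 - ‖z‖ ^ 2))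
    ((hc.norm.pow 2).mul (by fun_prop)) fun z hz => mul_nonneg (by positivity) (hpos hz)]
  have e1 : ∀ ρ ∈ Ioo (0 : ℝ) 1, ENNReal.ofReal (2 * Real.pi * ρ *
      circleAverage (fun z => ‖f z‖ ^ 2 * (1 - ‖z‖ ^ 2)) 0 ρ) =
      ∑' n : ℕ, ENNReal.ofReal (2 * Real.pi * ρ * (‖a n‖ ^ 2 * ρ ^ (2 * n) * (1 - ρ ^ 2))) := by
    rintro ρ ⟨h0, h1⟩
    have e2 : circleAverage (fun z => ‖f z‖ ^ 2 * (1 - ‖z‖ ^ 2)) 0 ρ =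
        (1 - ρ ^ 2) * meanSq f ρ := by
      rw [meanSq, ← smul_eq_mul, ← Real.circleAverage_fun_smul]
      apply Real.circleAverage_congr_sphere
      intro z hz
      have : ‖z‖ = ρ := by simpa [abs_of_pos h0] using hz
      simp [this, mul_comm]
    have hs := (((h.sq_coeff hc h0.le h1).2.mul_right (1 - ρ ^ 2)).mul_left (2 * Real.pi * ρ))
    have hρ : 0 ≤ 1 - ρ ^ 2 := by nlinarith
    rw [e2, mul_comm (1 - ρ ^ 2), ← hs.tsum_eq, ENNReal.ofReal_tsum_of_nonneg _ hs.summable]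
    intro n
    positivity
  rw [setLIntegral_congr_fun measurableSet_Ioo e1, lintegral_tsum]
  · congr 1; ext n
    rw [lintegral_ofReal_Ioo, integral_radial_weight]
    · fun_prop
    · rintro ρ ⟨h0, h1⟩
      have hρ : 0 ≤ 1 - ρ ^ 2 := by nlinarith
      positivity
  · intro n
    exact (Measurable.ennreal_ofReal (by fun_prop)).aemeasurable

lemma norm_sq_telescope (e S : ℂ) (n : ℕ) :
    ‖(n + 1) * e - S‖ ^ 2 / ((n + 1) * (n + 2)) =
      ‖e‖ ^ 2 + ‖S‖ ^ 2 / (n + 1) - ‖S + e‖ ^ 2 / (n + 2) := by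
  have h1 : (n : ℝ) + 1 ≠ 0 := by positivity
  have h2 : (n : ℝ) + 2 ≠ 0 := by positivity
  simp only [Complex.sq_norm, Complex.normSq_apply, Complex.sub_re, Complex.mul_re, Complex.add_re,
    Complex.natCast_re, Complex.one_re, Complex.add_im, Complex.natCast_im, Complex.one_im,
    Complex.sub_im, Complex.mul_im]
  field_simp
  ring

/-- The Taylor coefficients of `deriv G + G / (z - ζ)`. -/
def douglasCoeff (ζ : ℂ) (g : ℕ → ℂ) (n : ℕ) : ℂ :=
  (n + 1) * g (n + 1) - ∑ j ∈ Finset.range (n + 1), g j * (starRingEnd ℂ) ζ ^ (n - j + 1)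

lemma norm_douglasCoeff {ζ : ℂ} (hζ : ‖ζ‖ = 1) (g : ℕ → ℂ) (n : ℕ) :
    ‖douglasCoeff ζ g n‖ = ‖(n + 1) * (g (n + 1) * ζ ^ (n + 1)) -
      ∑ j ∈ Finset.range (n + 1), g j * ζ ^ j‖ := by
  have h : (starRingEnd ℂ) ζ * ζ = 1 := conj_mul_self_of_mem_sphere (by simpa using hζ)
  have : (n + 1) * (g (n + 1) * ζ ^ (n + 1)) - ∑ j ∈ Finset.range (n + 1), g j * ζ ^ j =
      douglasCoeff ζ g n * ζ ^ (n + 1) := by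
    rw [douglasCoeff, sub_mul, Finset.sum_mul, mul_assoc]
    congr 1
    refine Finset.sum_congr rfl fun j hj => ?_
    have hj' : n + 1 = (n - j + 1) + j := by
      have := Finset.mem_range.1 hj
      omega
    have e : ζ ^ (n + 1) = ζ ^ (n - j + 1) * ζ ^ j := by rw [← pow_add, ← hj']
    rw [e, mul_assoc, ← mul_assoc _ _ (ζ ^ j), ← mul_pow, h, one_pow, one_mul]
  rw [this, norm_mul, norm_pow, hζ, one_pow, mul_one]

lemma sum_norm_douglasCoeff {ζ : ℂ} (hζ : ‖ζ‖ = 1) (g : ℕ → ℂ) (N : ℕ) :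
    ∑ n ∈ Finset.range N, ‖douglasCoeff ζ g n‖ ^ 2 / ((n + 1) * (n + 2)) =
      ∑ k ∈ Finset.range (N + 1), ‖g k‖ ^ 2 -
        ‖∑ j ∈ Finset.range (N + 1), g j * ζ ^ j‖ ^ 2 / (N + 1) := by
  induction N with
  | zero => simp
  | succ N ih =>
    rw [Finset.sum_range_succ, ih, norm_douglasCoeff hζ, norm_sq_telescope,
      Finset.sum_range_succ (fun k => ‖g k‖ ^ 2) (N + 1),
      Finset.sum_range_succ (fun j => g j * ζ ^ j) (N + 1), norm_mul, norm_pow, hζ]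
    push_cast
    ring

lemma hasCoeffs_inv_sub {ζ : ℂ} (hζ : ‖ζ‖ = 1) :
    HasCoeffs (fun n => -(starRingEnd ℂ) ζ ^ (n + 1)) (fun z => (z - ζ)⁻¹) := by
  intro z hz
  have h : (starRingEnd ℂ) ζ * ζ = 1 := conj_mul_self_of_mem_sphere (by simpa using hζ)
  have h0 : ζ ≠ 0 := by rintro rfl; simp at hζ
  have hc : (starRingEnd ℂ) ζ = ζ⁻¹ := eq_inv_of_mul_eq_one_left h
  have hz1 := norm_lt_one_of_mem_disc hz
  have hzζ : z - ζ ≠ 0 := by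
    rw [← neg_ne_zero, neg_sub]; exact sub_ne_zero_of_norm_lt hζ hz1
  have := (hasSum_geometric_of_norm_lt_one (ξ := ζ⁻¹ * z) (by simpa [hζ] using hz1)).mul_left (-ζ⁻¹)
  have e1 : (fun n => -(starRingEnd ℂ) ζ ^ (n + 1) * z ^ n) = fun n => -ζ⁻¹ * (ζ⁻¹ * z) ^ n := by
    ext n
    rw [hc, mul_pow]
    ring
  have e2 : (z - ζ)⁻¹ = -ζ⁻¹ * (1 - ζ⁻¹ * z)⁻¹ := by
    have : 1 - ζ⁻¹ * z = -ζ⁻¹ * (z - ζ) := by field_simp; ring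
    rw [this, mul_inv]
    field_simp
  show HasSum (fun n => -(starRingEnd ℂ) ζ ^ (n + 1) * z ^ n) (z - ζ)⁻¹
  rw [e1, e2]
  exact this

lemma HasCoeffs.douglas {ζ : ℂ} (hζ : ‖ζ‖ = 1) {g : ℕ → ℂ} {G : ℂ → ℂ} (h : HasCoeffs g G)
    (hG : DifferentiableOn ℂ G disc) :
    HasCoeffs (douglasCoeff ζ g) (fun z => _root_.deriv G z + G z * (z - ζ)⁻¹) := by
  intro z hz
  have h1 := h.deriv hG z hz
  have hi := hasCoeffs_inv_sub hζ
  have h2 := hasSum_sum_range_mul_of_summable_norm (h.summable_norm hz) (hi.summable_norm hz)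
  rw [(h z hz).tsum_eq, (hi z hz).tsum_eq] at h2
  convert h1.add h2 using 2 with n
  rw [douglasCoeff, sub_mul, sub_eq_add_neg, Finset.sum_mul, ← Finset.sum_neg_distrib]
  congr 1
  refine Finset.sum_congr rfl fun j hj => ?_
  have hj' : z ^ n = z ^ j * z ^ (n - j) := by
    rw [← pow_add]; congr 1
    have := Finset.mem_range.1 hj
    omega
  rw [hj']; ring

lemma localDirichlet_eq_tsum {ζ : ℂ} (hζ : ‖ζ‖ = 1) {g : ℕ → ℂ} {G f : ℂ → ℂ} {c : ℂ}
    (h : HasCoeffs g G) (hG : DifferentiableOn ℂ G disc)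
    (hf : ∀ z ∈ disc, f z = c + (z - ζ) * G z) :
    localDirichlet ζ f = ∑' n : ℕ,
      ENNReal.ofReal (Real.pi * ‖douglasCoeff ζ g n‖ ^ 2 / ((n + 1) * (n + 2))) := by
  have hne : ∀ {z}, z ∈ disc → z - ζ ≠ 0 := fun {z} hz => by
    rw [← neg_ne_zero, neg_sub]; exact sub_ne_zero_of_norm_lt hζ (norm_lt_one_of_mem_disc hz)
  rw [← (h.douglas hζ hG).lintegral_sq (((hG.deriv isOpen_disc).continuousOn).add
    (hG.continuousOn.mul (ContinuousOn.inv₀ (by fun_prop) fun z hz => hne hz)))]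
  refine setLIntegral_congr_fun measurableSet_disc fun z hz => ?_
  have hd : deriv f z = (z - ζ) * (deriv G z + G z * (z - ζ)⁻¹) := by
    have hn := isOpen_disc.mem_nhds hz
    have e : f =ᶠ[𝓝 z] fun z => c + (z - ζ) * G z := by
      filter_upwards [hn] with w hw using hf w hw
    have := (((hasDerivAt_id z).sub_const ζ).mul
      (hG.differentiableAt hn).hasDerivAt).const_add c
    rw [e.deriv_eq, HasDerivAt.deriv (f := fun z => c + (z - ζ) * G z) this]
    have := hne hz
    simp only [id]
    field_simp
    ring
  rw [hd, diskKernel_eq hζ, norm_mul, norm_sub_rev z ζ]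
  have : ‖ζ - z‖ ≠ 0 := by
    rw [norm_sub_rev]; exact norm_ne_zero_iff.2 (hne hz)
  congr 1
  field_simp

lemma localDirichlet_le_of_sum_le {ζ : ℂ} (hζ : ‖ζ‖ = 1) {g : ℕ → ℂ} {G f : ℂ → ℂ} {c : ℂ}
    (h : HasCoeffs g G) (hG : DifferentiableOn ℂ G disc)
    (hf : ∀ z ∈ disc, f z = c + (z - ζ) * G z) {K : ℝ}
    (hK : ∀ N, ∑ k ∈ Finset.range N, ‖g k‖ ^ 2 ≤ K) :
    localDirichlet ζ f ≤ ENNReal.ofReal (Real.pi * K) := by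
  rw [localDirichlet_eq_tsum hζ h hG hf]
  refine ENNReal.tsum_le_of_sum_range_le fun N => ?_
  rw [← ENNReal.ofReal_sum_of_nonneg fun n _ => by positivity]
  refine ENNReal.ofReal_le_ofReal ?_
  simp only [mul_div_assoc]
  rw [← Finset.mul_sum, sum_norm_douglasCoeff hζ]
  refine mul_le_mul_of_nonneg_left ?_ Real.pi_pos.le
  have := hK (N + 1)
  have h2 : 0 ≤ ‖∑ j ∈ Finset.range (N + 1), g j * ζ ^ j‖ ^ 2 / ((N : ℝ) + 1) := by positivity
  linarith

lemma sum_le_localDirichlet {ζ : ℂ} (hζ : ‖ζ‖ = 1) {g : ℕ → ℂ} {G f : ℂ → ℂ} {c : ℂ}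
    (h : HasCoeffs g G) (hG : DifferentiableOn ℂ G disc)
    (hf : ∀ z ∈ disc, f z = c + (z - ζ) * G z) {M : ℕ} (hM : ∀ n, M ≤ n → g n = 0) :
    ENNReal.ofReal (Real.pi * ∑ k ∈ Finset.range M, ‖g k‖ ^ 2) ≤ localDirichlet ζ f := by
  rw [localDirichlet_eq_tsum hζ h hG hf]
  set K := ∑ k ∈ Finset.range M, ‖g k‖ ^ 2
  set S := ∑ k ∈ Finset.range M, g k * ζ ^ k
  have hlim : Tendsto (fun N : ℕ => ENNReal.ofReal (Real.pi * (K - ‖S‖ ^ 2 / (N + 1)))) atTop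
      (𝓝 (ENNReal.ofReal (Real.pi * K))) := by
    refine (ENNReal.continuous_ofReal.tendsto _).comp (Tendsto.const_mul _ ?_)
    have := (tendsto_const_div_atTop_nhds_zero_nat (‖S‖ ^ 2)).comp (tendsto_add_atTop_nat 1)
    simpa using (this.const_sub K)
  refine le_of_tendsto hlim ?_
  filter_upwards [eventually_ge_atTop M] with N hN
  refine le_trans (le_of_eq ?_) (ENNReal.sum_le_tsum (Finset.range N))
  rw [← ENNReal.ofReal_sum_of_nonneg fun n _ => by positivity]
  simp only [mul_div_assoc]
  rw [← Finset.mul_sum, sum_norm_douglasCoeff hζ]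
  have hsub : Finset.range M ⊆ Finset.range (N + 1) := Finset.range_subset_range.2 (by omega)
  have hz : ∀ n ∈ Finset.range (N + 1), n ∉ Finset.range M → g n = 0 := fun n _ hn =>
    hM n (by simpa using hn)
  rw [← Finset.sum_subset hsub fun n h1 h2 => by simp [hz n h1 h2],
    ← Finset.sum_subset hsub fun n h1 h2 => by simp [hz n h1 h2]]

lemma circleAverage_le_localDirichlet {ζ : ℂ} (hζ : ‖ζ‖ = 1) {f : ℂ → ℂ} {c : ℂ}
    (G : Polynomial ℂ) (hf : ∀ z ∈ disc, f z = c + (z - ζ) * G.eval z) :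
    ENNReal.ofReal (Real.pi * circleAverage (fun w => ‖G.eval w‖ ^ 2) 0 1) ≤
      localDirichlet ζ f := by
  have h : HasCoeffs G.coeff (fun z => G.eval z) := by
    intro z _
    dsimp only
    rw [Polynomial.eval_eq_sum_range]
    refine hasSum_sum_of_ne_finset_zero fun n hn => ?_
    rw [Polynomial.coeff_eq_zero_of_natDegree_lt (by simpa using hn), zero_mul]
  have := sum_le_localDirichlet hζ h G.differentiable.differentiableOn hf (M := G.natDegree + 1)
    fun n hn => Polynomial.coeff_eq_zero_of_natDegree_lt (by omega)
  rw [← Polynomial.sum_sq_norm_coeff_eq_circleAverage]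
  rwa [Finset.sum_subset Polynomial.supp_subset_range_natDegree_succ fun n _ hn => by
    simp [Polynomial.notMem_support_iff.1 hn]]

lemma circleAverage_re_of_circleIntegrable {f : ℂ → ℂ} {c : ℂ} {R : ℝ}
    (hf : CircleIntegrable f c R) :
    circleAverage (fun z => (f z).re) c R = (circleAverage f c R).re := by
  have := Complex.reCLM.intervalIntegral_comp_comm hf
  simp only [Complex.reCLM_apply] at this
  simp only [Real.circleAverage_def, Complex.real_smul, Complex.re_ofReal_mul, smul_eq_mul, this]

/-- The Fourier coefficients of a function on the unit circle. -/
def circleCoeff (g : ℂ → ℂ) (n : ℕ) : ℂ :=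
  circleAverage (fun w => g w * (starRingEnd ℂ) (w ^ n)) 0 1

lemma sum_sq_circleCoeff_le {g Q : ℂ → ℂ} (hg : CircleIntegrable g 0 1) (hQ : Continuous Q)
    (h : ∀ w ∈ sphere (0 : ℂ) 1, ‖g w‖ ≤ ‖Q w‖) (N : ℕ) :
    ∑ k ∈ Finset.range N, ‖circleCoeff g k‖ ^ 2 ≤ circleAverage (fun w => ‖Q w‖ ^ 2) 0 1 := by
  set P : Polynomial ℂ := ∑ k ∈ Finset.range N, Polynomial.monomial k (circleCoeff g k) with hP
  set S := ∑ k ∈ Finset.range N, ‖circleCoeff g k‖ ^ 2 with hS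
  have hcoeff : ∀ k, P.coeff k = if k ∈ Finset.range N then circleCoeff g k else 0 := by
    intro k
    simp [hP, Polynomial.coeff_monomial]
  have hPS : circleAverage (fun w => ‖P.eval w‖ ^ 2) 0 1 = S := by
    rw [← Polynomial.sum_sq_norm_coeff_eq_circleAverage, hS]
    have hsub : P.support ⊆ Finset.range N := fun k hk => by
      by_contra hk'
      rw [Polynomial.mem_support_iff, hcoeff, if_neg hk'] at hk
      exact hk rfl
    rw [Finset.sum_subset hsub fun n _ hn => by simp [Polynomial.notMem_support_iff.1 hn]]
    exact Finset.sum_congr rfl fun k hk => by rw [hcoeff, if_pos hk]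
  have hB : ∀ w : ℂ, HasSum (fun n => (starRingEnd ℂ) (P.coeff n) * (starRingEnd ℂ) (w ^ n))
      ((starRingEnd ℂ) (P.eval w)) := by
    intro w
    simp only [← map_mul]
    refine HasSum.map ?_ (starRingEnd ℂ) Complex.continuous_conj
    rw [Polynomial.eval_eq_sum_range]
    refine hasSum_sum_of_ne_finset_zero fun n hn => ?_
    rw [Polynomial.coeff_eq_zero_of_natDegree_lt (by simpa using hn), zero_mul]
  have hfin : ∀ n, n ∉ Finset.range N → (starRingEnd ℂ) (P.coeff n) = 0 := fun n hn => by
    rw [hcoeff, if_neg hn, map_zero]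
  have h1 := hasSum_circleAverage_mul (b := fun n => (starRingEnd ℂ) (P.coeff n))
    (summable_of_ne_finset_zero (s := Finset.range N) fun n hn => by rw [hfin n hn, norm_zero])
    (e := fun n w => (starRingEnd ℂ) (w ^ n))
    (fun n => (Complex.continuous_conj.comp (continuous_pow n)).continuousOn)
    (fun n w hw => by simp [mem_sphere_zero_iff_norm.1 hw]) (fun w _ => hB w) hg
  have h2 : circleAverage (fun w => g w * (starRingEnd ℂ) (P.eval w)) 0 1 = (S : ℂ) := by
    refine h1.unique ?_
    have : (S : ℂ) = ∑ n ∈ Finset.range N, (starRingEnd ℂ) (P.coeff n) * circleCoeff g n := by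
      rw [hS, Complex.ofReal_sum]
      refine Finset.sum_congr rfl fun k hk => ?_
      rw [hcoeff, if_pos hk, Complex.conj_mul']
      norm_cast
    rw [this]
    exact hasSum_sum_of_ne_finset_zero fun n hn => by rw [hfin n hn, zero_mul]
  have hgi : CircleIntegrable (fun w => g w * (starRingEnd ℂ) (P.eval w)) 0 1 := by
    have hc : Continuous fun t => (starRingEnd ℂ) (P.eval (circleMap 0 1 t)) :=
      Complex.continuous_conj.comp (P.continuous.comp (continuous_circleMap 0 1))
    exact IntervalIntegrable.mul_continuousOn hg hc.continuousOn
  have h3 : circleAverage (fun w => (g w * (starRingEnd ℂ) (P.eval w)).re) 0 1 = S := by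
    rw [circleAverage_re_of_circleIntegrable hgi, h2, Complex.ofReal_re]
  have iP : CircleIntegrable (fun w => ‖P.eval w‖ ^ 2) 0 1 :=
    circleIntegrable_of_continuousOn_unit (by fun_prop)
  have iQ : CircleIntegrable (fun w => ‖Q w‖ ^ 2) 0 1 :=
    circleIntegrable_of_continuousOn_unit (by fun_prop)
  have hre : CircleIntegrable (fun w => (g w * (starRingEnd ℂ) (P.eval w)).re) 0 1 := by
    rw [CircleIntegrable, intervalIntegrable_iff] at hgi ⊢
    exact hgi.re
  have h4 : circleAverage (fun w => (2 : ℝ) • (g w * (starRingEnd ℂ) (P.eval w)).re) 0 1 ≤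
      circleAverage (fun w => ‖P.eval w‖ ^ 2 + ‖Q w‖ ^ 2) 0 1 := by
    refine Real.circleAverage_mono (hre.const_smul (a := (2 : ℝ))) (iP.add iQ) fun w hw => ?_
    rw [abs_one] at hw
    have e1 : (g w * (starRingEnd ℂ) (P.eval w)).re ≤ ‖g w‖ * ‖P.eval w‖ := by
      refine (Complex.re_le_norm _).trans ?_
      rw [norm_mul, Complex.norm_conj]
    have e2 := h w hw
    have e3 : ‖g w‖ ^ 2 ≤ ‖Q w‖ ^ 2 := by gcongr
    rw [smul_eq_mul]
    nlinarith [sq_nonneg (‖g w‖ - ‖P.eval w‖)]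
  rw [Real.circleAverage_fun_smul (a := (2 : ℝ)), Real.circleAverage_fun_add iP iQ, h3, hPS,
    smul_eq_mul] at h4
  linarith

lemma hasSum_cauchyKernel {z w : ℂ} (hw : ‖w‖ = 1) (hz : ‖z‖ < 1) :
    HasSum (fun n => z ^ n * (starRingEnd ℂ) (w ^ n)) (w / (w - z)) := by
  have h : (starRingEnd ℂ) w * w = 1 := conj_mul_self_of_mem_sphere (by simpa using hw)
  have h0 : w ≠ 0 := by rintro rfl; simp at hw
  have hc : (starRingEnd ℂ) w = w⁻¹ := eq_inv_of_mul_eq_one_left h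
  have hwz := sub_ne_zero_of_norm_lt hw hz
  have := hasSum_geometric_of_norm_lt_one (ξ := z * w⁻¹) (by simpa [hw] using hz)
  have e : (1 - z * w⁻¹)⁻¹ = w / (w - z) := by
    have : 1 - z * w⁻¹ = (w - z) / w := by field_simp
    rw [this, inv_div]
  simpa only [e, mul_pow, map_pow, hc] using this

lemma hasSum_cauchyIntegral {g : ℂ → ℂ} (hg : CircleIntegrable g 0 1) {z : ℂ} (hz : ‖z‖ < 1) :
    HasSum (fun n => circleCoeff g n * z ^ n)
      (circleAverage (fun w => g w * (w / (w - z))) 0 1) := by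
  have := hasSum_circleAverage_mul (b := fun n => z ^ n)
    (by simpa using summable_geometric_of_lt_one (norm_nonneg z) hz)
    (e := fun n w => (starRingEnd ℂ) (w ^ n))
    (fun n => (Complex.continuous_conj.comp (continuous_pow n)).continuousOn)
    (fun n w hw => by simp [mem_sphere_zero_iff_norm.1 hw])
    (fun w hw => hasSum_cauchyKernel (mem_sphere_zero_iff_norm.1 hw) hz) hg
  simpa only [mul_comm (z ^ _), circleCoeff] using this

lemma circleAverage_cauchyKernel {z : ℂ} (hz : ‖z‖ < 1) :
    circleAverage (fun w => w / (w - z)) 0 1 = 1 := by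
  have h := hasSum_cauchyIntegral (g := fun _ => 1) (circleIntegrable_const 1 0 1) hz
  have e : ∀ n, circleCoeff (fun _ => 1) n * z ^ n = if n = 0 then 1 else 0 := by
    intro n
    have := circleAverage_conj_pow_mul_pow n 0
    simp only [pow_zero, mul_one] at this
    rw [circleCoeff]
    simp only [one_mul, this]
    rcases eq_or_ne n 0 with rfl | hn
    · simp
    · simp [hn, hn.symm]
  simp only [e, one_mul] at h
  exact h.unique (hasSum_ite_eq 0 1)

lemma herglotz_comp_bpt (U : ℂ → ℝ) (z : ℂ) : herglotz (fun t => U (bpt t)) z =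
    circleAverage (fun w => (w + z) / (w - z) * (U w : ℂ)) 0 1 := by
  rw [herglotz, Real.circleAverage_def, Real.circleAverage_def]
  congr 1
  refine intervalIntegral.integral_congr_ae (ae_of_all _ fun t ht => ?_)
  rw [uIoc_two_pi] at ht
  simp [herglotzRieszKernel_def, circleMap_one_eq_bpt, boundaryLift_bpt _ ht]

lemma herglotz_eq_add_mul {ζ : ℂ} {U : ℂ → ℝ} {g : ℂ → ℂ}
    (hg : CircleIntegrable g 0 1) (h : ∀ w, (U w : ℂ) = U ζ + (w - ζ) * g w) {z : ℂ}
    (hz : ‖z‖ < 1) :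
    herglotz (fun t => U (bpt t)) z =
      (U ζ + circleAverage (fun w => (w + ζ) * g w) 0 1) +
        (z - ζ) * (2 * circleAverage (fun w => g w * (w / (w - z))) 0 1) := by
  have hne : ∀ w ∈ sphere (0 : ℂ) 1, w - z ≠ 0 := fun w hw =>
    sub_ne_zero_of_norm_lt (mem_sphere_zero_iff_norm.1 hw) hz
  have hk : ContinuousOn (fun w => w / (w - z)) (sphere (0 : ℂ) 1) :=
    continuousOn_id.div (by fun_prop) hne
  have hmul : ∀ {k : ℂ → ℂ}, ContinuousOn k (sphere (0 : ℂ) 1) →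
      CircleIntegrable (fun w => k w * g w) 0 1 := fun {k} hk =>
    IntervalIntegrable.continuousOn_mul hg
      (hk.comp (continuous_circleMap 0 1).continuousOn fun t _ => by simp)
  have i1 : CircleIntegrable (fun w => 2 * (U ζ : ℂ) * (w / (w - z))) 0 1 :=
    circleIntegrable_of_continuousOn_unit (continuousOn_const.mul hk)
  have i2 : CircleIntegrable (fun _ : ℂ => (U ζ : ℂ)) 0 1 := circleIntegrable_const _ 0 1
  have i3 : CircleIntegrable (fun w => (w + ζ) * g w) 0 1 := hmul (by fun_prop)
  have i4 : CircleIntegrable (fun w => (z - ζ) * 2 * (g w * (w / (w - z)))) 0 1 := by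
    have := (hmul hk).const_smul (a := (z - ζ) * 2)
    simpa only [Pi.smul_def, smul_eq_mul, mul_comm (_ / _)] using this
  have i12 : CircleIntegrable (fun w => 2 * (U ζ : ℂ) * (w / (w - z)) - U ζ) 0 1 := i1.sub i2
  have i123 : CircleIntegrable
    (fun w => 2 * (U ζ : ℂ) * (w / (w - z)) - U ζ + (w + ζ) * g w) 0 1 := i12.add i3
  have e : circleAverage (fun w => (w + z) / (w - z) * (U w : ℂ)) 0 1 =
      circleAverage (fun w => (((2 * (U ζ : ℂ) * (w / (w - z))) - U ζ) + (w + ζ) * g w) +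
        (z - ζ) * 2 * (g w * (w / (w - z)))) 0 1 := by
    apply Real.circleAverage_congr_sphere
    intro w hw
    rw [abs_one] at hw
    have := hne w hw
    dsimp only
    rw [h w]
    field_simp
    ring
  have s2 := Real.circleAverage_fun_smul (𝕜 := ℂ) (a := 2 * (U ζ : ℂ))
    (f := fun w => w / (w - z)) (c := 0) (R := 1)
  have s4 := Real.circleAverage_fun_smul (𝕜 := ℂ) (a := (z - ζ) * 2)
    (f := fun w => g w * (w / (w - z))) (c := 0) (R := 1)
  simp only [smul_eq_mul] at s2 s4
  rw [herglotz_comp_bpt, e, Real.circleAverage_fun_add i123 i4,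
    Real.circleAverage_fun_add i12 i3, Real.circleAverage_fun_sub i1 i2, s2, s4,
    circleAverage_cauchyKernel hz, Real.circleAverage_const]
  ring

lemma localDirichlet_herglotz_le {ζ : ℂ} (hζ : ‖ζ‖ = 1) {U : ℂ → ℝ} (hU : Continuous U)
    {Q : ℂ → ℂ} (hQ : Continuous Q) (h : ∀ w, |U w - U ζ| ≤ ‖w - ζ‖ * ‖Q w‖) :
    localDirichlet ζ (herglotz fun t => U (bpt t)) ≤
      ENNReal.ofReal (Real.pi * (4 * circleAverage (fun w => ‖Q w‖ ^ 2) 0 1)) := by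
  set g : ℂ → ℂ := fun w => ((U w - U ζ : ℝ) : ℂ) / (w - ζ) with hgdef
  have hgQ : ∀ w, ‖g w‖ ≤ ‖Q w‖ := by
    intro w
    rcases eq_or_ne (w - ζ) 0 with h0 | h0
    · simp [hgdef, h0]
    · rw [hgdef, norm_div, Complex.norm_real, Real.norm_eq_abs, div_le_iff₀ (norm_pos_iff.2 h0),
        mul_comm]
      exact h w
  have hUg : ∀ w, (U w : ℂ) = U ζ + (w - ζ) * g w := by
    intro w
    rcases eq_or_ne (w - ζ) 0 with h0 | h0
    · rw [sub_eq_zero.1 h0]; simp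
    · rw [hgdef]; push_cast; field_simp; ring
  have hgm : Measurable g := by
    have := hU.measurable
    fun_prop
  have hg : CircleIntegrable g 0 1 := by
    have hQi : CircleIntegrable (fun w => ‖Q w‖) 0 1 :=
      circleIntegrable_of_continuousOn_unit (by fun_prop)
    rw [CircleIntegrable, intervalIntegrable_iff] at hQi ⊢
    exact hQi.mono' (hgm.comp (continuous_circleMap 0 1).measurable).aestronglyMeasurable
      (ae_of_all _ fun t => hgQ _)
  have hu : IntegrableOn (fun t => U (bpt t)) (Ioc 0 (2 * Real.pi)) :=
    ((hU.comp continuous_bpt).integrableOn_Icc).mono_set Ioc_subset_Icc_self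
  set G : ℂ → ℂ := fun z => 2 * circleAverage (fun w => g w * (w / (w - z))) 0 1 with hGdef
  have hf : ∀ z ∈ disc, herglotz (fun t => U (bpt t)) z =
      (U ζ + circleAverage (fun w => (w + ζ) * g w) 0 1) + (z - ζ) * G z := fun z hz =>
    herglotz_eq_add_mul hg hUg (norm_lt_one_of_mem_disc hz)
  have hcoef : HasCoeffs (fun n => 2 * circleCoeff g n) G := by
    intro z hz
    simpa only [mul_assoc] using
      (hasSum_cauchyIntegral hg (norm_lt_one_of_mem_disc hz)).mul_left 2
  have hG : DifferentiableOn ℂ G disc := by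
    have hne : ∀ z ∈ disc, z - ζ ≠ 0 := fun z hz => by
      rw [← neg_ne_zero, neg_sub]
      exact sub_ne_zero_of_norm_lt hζ (norm_lt_one_of_mem_disc hz)
    refine (((differentiableOn_herglotz hu).sub_const
      (U ζ + circleAverage (fun w => (w + ζ) * g w) 0 1)).div
      (by fun_prop : DifferentiableOn ℂ (fun z => z - ζ) disc) hne).congr fun z hz => ?_
    have := hne z hz
    rw [Pi.div_apply, hf z hz]
    field_simp
    ring
  refine localDirichlet_le_of_sum_le hζ hcoef hG hf fun N => ?_
  have := sum_sq_circleCoeff_le hg hQ (fun w _ => hgQ w) N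
  simp only [norm_mul, mul_pow, ← Finset.mul_sum]
  norm_num
  linarith

lemma localDirichlet_herglotz_norm_le {ζ : ℂ} (hζ : ‖ζ‖ = 1) (p : Polynomial ℂ) :
    localDirichlet ζ (herglotz fun t => 2 * ‖p.eval (bpt t)‖) ≤
      ENNReal.ofReal 16 * localDirichlet ζ (fun z => p.eval z) := by
  set G := p /ₘ (Polynomial.X - Polynomial.C ζ) with hG
  have hp : ∀ z, p.eval z = p.eval ζ + (z - ζ) * G.eval z := by
    intro z
    conv_lhs => rw [← Polynomial.modByMonic_add_div p (Polynomial.X - Polynomial.C ζ)]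
    rw [Polynomial.modByMonic_X_sub_C_eq_C_eval]
    simp [hG]
  have h1 := circleAverage_le_localDirichlet hζ G fun z _ => hp z
  have h2 := localDirichlet_herglotz_le hζ (U := fun w => 2 * ‖p.eval w‖) (by fun_prop)
    (Q := fun w => 2 * G.eval w) (by fun_prop) fun w => by
      have : p.eval w - p.eval ζ = (w - ζ) * G.eval w := by rw [hp w]; ring
      rw [← mul_sub, abs_mul, norm_mul, mul_left_comm, ← norm_mul, ← this]
      simpa using abs_norm_sub_norm_le (p.eval w) (p.eval ζ)
  refine h2.trans (le_trans (le_of_eq ?_) (mul_le_mul_right h1 (ENNReal.ofReal 16)))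
  have e : circleAverage (fun w => ‖2 * G.eval w‖ ^ 2) 0 1 =
      4 * circleAverage (fun w => ‖G.eval w‖ ^ 2) 0 1 := by
    rw [← smul_eq_mul (4 : ℝ), ← Real.circleAverage_fun_smul (a := (4 : ℝ))]
    congr 1
    ext w
    rw [norm_mul, mul_pow, Complex.norm_ofNat, smul_eq_mul]
    norm_num
  rw [e, ← ENNReal.ofReal_mul (by norm_num)]
  congr 1
  ring

lemma circleAverage_normSq_le_hardyNormSq {f : ℂ → ℂ} (hf : Continuous f)
    (hb : BddAbove (hardySet f)) : circleAverage (fun w => ‖f w‖ ^ 2) 0 1 ≤ hardyNormSq f := by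
  have hc : Continuous fun r : ℝ => meanSq f r := by
    have h : Continuous fun r : ℝ => ∫ t in (0 : ℝ)..2 * Real.pi, ‖f (circleMap 0 r t)‖ ^ 2 := by
      refine intervalIntegral.continuous_parametric_intervalIntegral_of_continuous' ?_ _ _
      simp only [circleMap, Function.uncurry_def]
      fun_prop
    exact h.const_smul (2 * Real.pi)⁻¹
  have : Tendsto (meanSq f) (𝓝[<] 1) (𝓝 (meanSq f 1)) := hc.continuousWithinAt (s := Iio 1)
  refine le_of_tendsto this ?_
  filter_upwards [Ioo_mem_nhdsLT (show (0 : ℝ) < 1 by norm_num)] with r hr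
  exact meanSq_le_hardyNormSq hb hr.1 hr.2

lemma memDh_norm_polynomial [IsFiniteMeasure μ] (hμ : OnCircle μ) (p : Polynomial ℂ) :
    MemDh μ (fun t => 2 * ‖p.eval (bpt t)‖) ∧
      dhNormSq μ (fun t => 2 * ‖p.eval (bpt t)‖) ≤ 16 * dNormSq μ (fun z => p.eval z) := by
  have hp := memD_polynomial hμ p
  have hpt : energy μ (fun z => p.eval z) ≠ ⊤ := (integrableOn_dirichletDensity_iff _).1 hp.2
  have hcont : Continuous fun t => 2 * ‖p.eval (bpt t)‖ := by
    have := continuous_bpt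
    fun_prop
  have hu : IntegrableOn (fun t => 2 * ‖p.eval (bpt t)‖) (Ioc 0 (2 * Real.pi)) :=
    hcont.integrableOn_Icc.mono_set Ioc_subset_Icc_self
  have hle : energy μ (herglotz fun t => 2 * ‖p.eval (bpt t)‖) ≤
      ENNReal.ofReal 16 * energy μ (fun z => p.eval z) := by
    rw [energy_eq hμ, energy_eq hμ, ← lintegral_const_mul' _ _ ENNReal.ofReal_ne_top]
    refine lintegral_mono_ae ?_
    filter_upwards [hμ.ae_norm] with ζ hζ using localDirichlet_herglotz_norm_le hζ p
  have htop : ENNReal.ofReal 16 * energy μ (fun z => p.eval z) ≠ ⊤ :=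
    ENNReal.mul_ne_top ENNReal.ofReal_ne_top hpt
  refine ⟨(memDh_iff hu).2 ⟨(hcont.pow 2).integrableOn_Icc.mono_set Ioc_subset_Icc_self,
    ne_top_of_le_ne_top htop hle⟩, ?_⟩
  have hE := ENNReal.toReal_mono htop hle
  rw [ENNReal.toReal_mul, ENNReal.toReal_ofReal (by norm_num)] at hE
  have hH := circleAverage_normSq_le_hardyNormSq p.continuous hp.1.2
  have e : (1 / (2 * Real.pi)) * (∫ t in Ioc 0 (2 * Real.pi), (2 * ‖p.eval (bpt t)‖) ^ 2) =
      4 * circleAverage (fun w => ‖p.eval w‖ ^ 2) 0 1 := by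
    rw [circleAverage_eq_bpt, intervalIntegral.integral_of_le Real.two_pi_pos.le]
    simp only [mul_pow, integral_const_mul]
    ring
  rw [dhNormSq_eq hu, dNormSq_eq, e]
  have h0 := hardyNormSq_nonneg (fun z => p.eval z)
  have h3 : (1 / Real.pi) * (energy μ (herglotz fun t => 2 * ‖p.eval (bpt t)‖)).toReal ≤
      (1 / Real.pi) * (16 * (energy μ fun z => p.eval z).toReal) := by gcongr
  linarith

lemma IsBPE.of_cap_pos [IsFiniteMeasure μ] (hμ : OnCircle μ) {ζ : ℂ} (hζ : ‖ζ‖ = 1)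
    (h : 0 < cap μ {ζ}) : IsBPE μ ζ := by
  by_contra hn
  refine h.not_ge (le_of_forall_gt_imp_ge_of_dense fun ε hε => ?_)
  obtain ⟨δ, hδ0, hδ⟩ : ∃ δ : ℝ, 0 < δ ∧ ENNReal.ofReal (16 * δ) ≤ ε := by
    rcases eq_or_ne ε ⊤ with rfl | ht
    · exact ⟨1, one_pos, le_top⟩
    · refine ⟨ε.toReal / 16, by have := ENNReal.toReal_pos hε.ne' ht; positivity, ?_⟩
      rw [mul_div_cancel₀ _ (by norm_num), ENNReal.ofReal_toReal ht]
  obtain ⟨p, hp1, hp⟩ := exists_polynomial_eval_eq_one hμ hn hδ0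
  obtain ⟨hm, hd⟩ := memDh_norm_polynomial hμ p
  have hV : IsOpen {w : ℂ | 1 < 2 * ‖p.eval w‖} := isOpen_lt (by fun_prop) (by fun_prop)
  have hζV : ({ζ} : Set ℂ) ⊆ {w : ℂ | 1 < 2 * ‖p.eval w‖} ∩ circleT := by
    rintro _ rfl
    exact ⟨by simp [hp1], by simpa [circleT] using hζ⟩
  refine (iInf₂_le _ ⟨⟨_, hV, rfl⟩, hζV⟩).trans ?_
  refine (iInf₂_le _ ⟨hm, fun t => by positivity, ae_of_all _ fun t ht => ht.1.le⟩).trans ?_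
  exact (ENNReal.ofReal_le_ofReal (by linarith)).trans hδ

end

/-- `ζ` is a bounded point evaluation of `D(μ)` iff `z - ζ` is not cyclic
iff `c_μ({ζ}) > 0`. -/
theorem bounded_point_evaluation_tfae
    (μ : Measure ℂ) [IsFiniteMeasure μ] (hμ : OnCircle μ)
    (ζ : ℂ) (hζ : ζ ∈ circleT) :
    ((∃ C > (0:ℝ), ∀ q : Polynomial ℂ,
        ‖q.eval ζ‖ ≤ C * Real.sqrt (dNormSq μ (fun z => q.eval z))) ↔
      ¬ IsCyclic μ (fun z => z - ζ)) ∧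
    ((¬ IsCyclic μ (fun z => z - ζ)) ↔ 0 < cap μ {ζ}) := by
  have hζ1 : ‖ζ‖ = 1 := mem_sphere_zero_iff_norm.1 hζ
  have h : IsBPE μ ζ ↔ ¬ IsCyclic μ (fun z => z - ζ) :=
    ⟨fun h => h.not_isCyclic hμ, fun h => by_contra fun hn => h (isCyclic_of_not_isBPE hμ hn)⟩
  exact ⟨h, h.symm.trans ⟨fun hb => hb.cap_pos hμ hζ1, fun hc => .of_cap_pos hμ hζ1 hc⟩⟩

end DirichletMu
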